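/- arXiv:1407.7279 — 3 statements merged into one kernel-verified Lean document; each statement's English description precedes it below -/
import Mathlib

section
/- Let U = {1,…,m}, let S = {s_1,…,s_n} be a family of subsets of U, and let k be a positive integer. Construct the comb G with backbone b_0 b_1 … b_{m+n+1}, teeth v_1,…,v_m with edges (b_i,v_i) for 1 ≤ i ≤ m, teeth p_1,…,p_n with edges (b_{m+i},p_i) for 1 ≤ i ≤ n, and check teeth p_0, p_{n+1} with edges (b_0,p_0) and (b_{m+n+1},p_{n+1}). Let B be the set of all backbone edges, and define the static graphs on this vertex set: back with edge set B; pass(i) with edge set B ∪ {(b_{m+i},p_i)}; take(i) with edge set B ∪ {(b_j,v_j) : j ∈ s_i}; check with edge set {(b_0,p_0)}; and finish with edge set B ∪ {(b_{m+i},p_i) : 1 ≤ i ≤ n+1}. Let 𝒢 be the TVG (back,m+n),(pass(1),1),(take(1),3m),(pass(1),1),(back,m+n),(pass(2),1),(take(2),3m),(pass(2),1),…,(back,m+n),(pass(n),1),(take(n),3m),(pass(n),1),(back,m+n),(check,2),(finish,m+n+2+2k), and let D be the total duration of 𝒢. Then there exists a journey starting at b_0 at time 0 that visits every vertex of G and arrives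 by time D if and only if S contains a subfamily of at most k sets whose union is U. -/
/-- A time-varying graph (TVG): an underlying simple graph together with a presence
function telling when each (directed rendering of an) edge is available; every edge
takes one time step to cross. -/
structure TVG (V : Type) where
  G : SimpleGraph V
  avail : V → V → ℕ → Prop

namespace TVG

variable {V : Type}

/-- A step of a journey: traverse the edge from `x.1` to `x.2.1`, starting at time
`x.2.2` and arriving at time `x.2.2 + 1`. -/
abbrev Step (V : Type) := V × V × ℕ

/-- Consecutive steps of a journey: the next step starts where the previous one ended,
at a strictly later time (waiting in between is allowed). -/
def Linked (a b : Step V) : Prop := b.1 = a.2.1 ∧ a.2.2 + 1 ≤ b.2.2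

/-- A journey: each step crosses an edge of the underlying graph that is available at
that time, and consecutive steps are linked. -/
def IsJourney (𝒢 : TVG V) (J : List (Step V)) : Prop :=
  (∀ x ∈ J, 𝒢.G.Adj x.1 x.2.1 ∧ 𝒢.avail x.1 x.2.1 x.2.2) ∧ J.Chain' Linked

/-- The journey starts at vertex `u`. -/
def startsAt (J : List (Step V)) (u : V) : Prop := ∀ x ∈ J.head?, x.1 = u

/-- The journey departs at or after time `t`. -/
def departsAfter (J : List (Step V)) (t : ℕ) : Prop := ∀ x ∈ J.head?, t ≤ x.2.2

/-- Departure date of a journey started at time `t0`. -/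
def departure (J : List (Step V)) (t0 : ℕ) : ℕ := (J.head?).elim t0 fun x => x.2.2

/-- Arrival date of a journey started at time `t0`. -/
def arrival (J : List (Step V)) (t0 : ℕ) : ℕ := (J.getLast?).elim t0 fun x => x.2.2 + 1

/-- Final vertex of a journey started at vertex `s`. -/
def endAt (J : List (Step V)) (s : V) : V := (J.getLast?).elim s fun x => x.2.1

/-- The journey, started at `s`, visits (covers) vertex `v`. -/
def visits (J : List (Step V)) (s v : V) : Prop := v = s ∨ ∃ x ∈ J, x.2.1 = v

/-- A covering journey from `s` starting at time `0`: a journey that starts at `s`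
and visits every vertex. -/
def IsCoveringFrom (𝒢 : TVG V) (J : List (Step V)) (s : V) : Prop :=
  𝒢.IsJourney J ∧ startsAt J s ∧ ∀ v : V, visits J s v

/-- Class `R` (recurrent edges): connected underlying graph, lifetime `ℕ`, and every
edge is available at arbitrarily late times. -/
def ClassR (𝒢 : TVG V) : Prop :=
  𝒢.G.Connected ∧ ∀ u v, 𝒢.G.Adj u v → ∀ t, ∃ t', t < t' ∧ 𝒢.avail u v t'

/-- Class `B` (time-bounded recurrent edges): every edge is available at some time in
`[t, t + Δ)` for every `t`. -/
def ClassB (𝒢 : TVG V) (Δ : ℕ) : Prop :=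
  𝒢.G.Connected ∧ ∀ u v, 𝒢.G.Adj u v → ∀ t, ∃ t', t ≤ t' ∧ t' < t + Δ ∧ 𝒢.avail u v t'

/-- Class `P` (periodic edges): the presence function is periodic with period `p`. -/
def ClassP (𝒢 : TVG V) (p : ℕ) : Prop :=
  𝒢.G.Connected ∧ ∀ u v t, 𝒢.avail u v t ↔ 𝒢.avail u v (t + p)

/-- Presence function obtained by running the given (possibly time-dependent) edge
relations for the given durations, one block after another, starting at time `0`;
each block relation receives the local time within its block. -/
def schedAvail : List ((V → V → ℕ → Prop) × ℕ) → V → V → ℕ → Prop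
  | [], _, _, _ => False
  | (r, d) :: rest, u, v, t => if t < d then r u v t else schedAvail rest u v (t - d)

end TVG

open TVG

namespace Stmt4

/-- Vertices of the comb: backbone `b_0,…,b_{m+n+1}`, element teeth `v_1,…,v_m`
(`elt j` is `v_{j+1}`), and teeth `p_0,…,p_{n+1}`. -/
abbrev CV (m n : ℕ) := Fin (m + n + 2) ⊕ Fin m ⊕ Fin (n + 2)

variable {m n : ℕ}

def bb (i : Fin (m + n + 2)) : CV m n := Sum.inl i
def elt (j : Fin m) : CV m n := Sum.inr (Sum.inl j)
def pt (i : Fin (n + 2)) : CV m n := Sum.inr (Sum.inr i)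

/-- Backbone vertex `b_{j+1}` carrying the element tooth `v_{j+1}`. -/
def eAt (j : Fin m) : Fin (m + n + 2) := ⟨j.val + 1, by have := j.isLt; omega⟩

/-- The backbone vertex to which tooth `p_i` is attached: `b_0` for `p_0`,
`b_{m+i}` for `1 ≤ i ≤ n`, and `b_{m+n+1}` for `p_{n+1}`. -/
def attach (i : Fin (n + 2)) : Fin (m + n + 2) :=
  if i.val = 0 then ⟨0, by omega⟩
  else if i.val = n + 1 then ⟨m + n + 1, by omega⟩
  else ⟨m + i.val, by have := i.isLt; omega⟩

/-- Backbone edges. -/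
def backE (u v : CV m n) : Prop :=
  ∃ i j : Fin (m + n + 2), j.val = i.val + 1 ∧ u = bb i ∧ v = bb j

/-- The underlying comb. -/
def combG (m n : ℕ) : SimpleGraph (CV m n) :=
  SimpleGraph.fromRel (fun u v => backE u v ∨
    (∃ j : Fin m, u = bb (eAt j) ∧ v = elt j) ∨
    (∃ i : Fin (n + 2), u = bb (attach i) ∧ v = pt i))

def sym (r : CV m n → CV m n → Prop) : CV m n → CV m n → ℕ → Prop :=
  fun u v _ => r u v ∨ r v u

/-- Index of the tooth `p_{i+1}` corresponding to the set `s_{i+1}`. -/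
def pIdx (i : Fin n) : Fin (n + 2) := ⟨i.val + 1, by have := i.isLt; omega⟩

/-- `back`: backbone edges only. -/
def backR : CV m n → CV m n → ℕ → Prop := sym backE

/-- `pass(i)`: the backbone together with the tooth edge of `p_{i+1}`. -/
def passR (i : Fin n) : CV m n → CV m n → ℕ → Prop :=
  sym fun u v => backE u v ∨ (u = bb (attach (pIdx i)) ∧ v = pt (pIdx i))

/-- `take(i)`: the backbone together with the tooth edges `(b_j, v_j)` for `j ∈ s_i`. -/
def takeR (s : Finset (Fin m)) : CV m n → CV m n → ℕ → Prop :=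
  sym fun u v => backE u v ∨ ∃ j ∈ s, u = bb (eAt j) ∧ v = elt j

/-- `check`: only the edge `(b_0, p_0)`. -/
def checkR : CV m n → CV m n → ℕ → Prop :=
  sym fun u v => u = bb (attach 0) ∧ v = pt 0

/-- `finish`: the backbone together with the tooth edges of `p_1,…,p_{n+1}`. -/
def finishR : CV m n → CV m n → ℕ → Prop :=
  sym fun u v => backE u v ∨
    ∃ i : Fin (n + 2), 1 ≤ i.val ∧ u = bb (attach i) ∧ v = pt i

/-- The schedule `(back,m+n),(pass(1),1),(take(1),3m),(pass(1),1),(back,m+n),…,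
(pass(n),1),(take(n),3m),(pass(n),1),(back,m+n),(check,2),(finish,m+n+2+2k)`. -/
def blocks (S : Fin n → Finset (Fin m)) (k : ℕ) :
    List ((CV m n → CV m n → ℕ → Prop) × ℕ) :=
  (backR, m + n) ::
    (((List.finRange n).flatMap fun i =>
      [(passR i, 1), (takeR (S i), 3 * m), (passR i, 1), (backR, m + n)])
    ++ [(checkR, 2), (finishR, m + n + 2 + 2 * k)])

/-- The TVG of the reduction. -/
def 𝒢 (S : Fin n → Finset (Fin m)) (k : ℕ) : TVG (CV m n) :=
  ⟨combG m n, schedAvail (blocks S k)⟩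

/-- The total duration `D` of the TVG. -/
def D (S : Fin n → Finset (Fin m)) (k : ℕ) : ℕ := ((blocks S k).map Prod.snd).sum

end Stmt4


namespace Aux
open Stmt4

section Gen
variable {V : Type}

lemma sched_cons (r : V → V → ℕ → Prop) (d : ℕ) (l : List ((V → V → ℕ → Prop) × ℕ)) (u v : V) (t : ℕ) :
    schedAvail ((r, d) :: l) u v t ↔
      (t < d ∧ r u v t) ∨ ∃ t', t = d + t' ∧ schedAvail l u v t' := by
  simp only [schedAvail]
  split_ifs with h
  · constructor
    · intro h'; exact Or.inl ⟨h, h'⟩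
    · rintro (h' | ⟨t', h1, _⟩)
      · exact h'.2
      · omega
  · constructor
    · intro h'; exact Or.inr ⟨t - d, by omega, h'⟩
    · rintro (h' | ⟨t', h1, h2⟩)
      · exact absurd h'.1 h
      · subst h1; simpa using h2

lemma sched_append (l1 l2 : List ((V → V → ℕ → Prop) × ℕ)) (u v : V) (t : ℕ) :
    schedAvail (l1 ++ l2) u v t ↔
      schedAvail l1 u v t ∨ ∃ t', t = (l1.map Prod.snd).sum + t' ∧ schedAvail l2 u v t' := by
  induction l1 generalizing t with
  | nil => simp [schedAvail]
  | cons a l ih =>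
    obtain ⟨r, d⟩ := a
    simp only [List.cons_append, sched_cons, ih, List.map_cons, List.sum_cons]
    constructor
    · rintro (h | ⟨t', rfl, h | ⟨t'', rfl, h⟩⟩)
      · exact Or.inl (Or.inl h)
      · exact Or.inl (Or.inr ⟨t', rfl, h⟩)
      · exact Or.inr ⟨t'', by omega, h⟩
    · rintro ((h | ⟨t', rfl, h⟩) | ⟨t', rfl, h⟩)
      · exact Or.inl h
      · exact Or.inr ⟨t', rfl, Or.inl h⟩
      · exact Or.inr ⟨_, by rw [Nat.add_assoc], Or.inr ⟨t', rfl, h⟩⟩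

lemma sum_flat {α : Type} (f : α → List ((V → V → ℕ → Prop) × ℕ)) (L : ℕ)
    (hL : ∀ a, ((f a).map Prod.snd).sum = L) (l : List α) :
    ((l.flatMap f).map Prod.snd).sum = l.length * L := by
  induction l with
  | nil => simp
  | cons a l ih => rw [List.flatMap_cons, List.map_append, List.sum_append, ih, hL, List.length_cons]; ring

lemma sched_flat {α : Type} (f : α → List ((V → V → ℕ → Prop) × ℕ)) (L : ℕ)
    (hL : ∀ a, ((f a).map Prod.snd).sum = L) (l : List α) (u v : V) (t : ℕ) :
    schedAvail (l.flatMap f) u v t ↔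
      ∃ (q r : ℕ) (h : q < l.length), t = q * L + r ∧ schedAvail (f l[q]) u v r := by
  induction l generalizing t with
  | nil => simp [schedAvail]
  | cons a l ih =>
    rw [List.flatMap_cons, sched_append, hL]
    constructor
    · rintro (h | ⟨t', rfl, h⟩)
      · exact ⟨0, t, by simp, by simp, by simpa using h⟩
      · rw [ih] at h
        obtain ⟨q, r, hq, rfl, h⟩ := h
        exact ⟨q + 1, r, by simpa using hq, by ring, by simpa using h⟩
    · rintro ⟨q, r, hq, rfl, h⟩
      cases q with
      | zero => left; simpa using h
      | succ q =>
        right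
        refine ⟨q * L + r, by ring, ?_⟩
        rw [ih]
        exact ⟨q, r, by simpa using hq, rfl, by simpa using h⟩

/-- Journeys give trajectories. -/
lemma traj_of_journey (A : V → V → ℕ → Prop) (J : List (Step V)) (s : V) (t0 : ℕ)
    (h1 : ∀ x ∈ J, A x.1 x.2.1 x.2.2) (h2 : J.IsChain Linked)
    (h3 : startsAt J s) (h4 : departsAfter J t0) :
    ∃ pos : ℕ → V, pos t0 = s ∧
      (∀ t, t0 ≤ t → pos (t+1) = pos t ∨ A (pos t) (pos (t+1)) t) ∧
      ∀ x ∈ J, t0 ≤ x.2.2 ∧ pos (x.2.2 + 1) = x.2.1 := by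
  induction J generalizing s t0 with
  | nil => exact ⟨fun _ => s, rfl, fun _ _ => Or.inl rfl, by simp⟩
  | cons x J ih =>
    obtain ⟨a, b, τ⟩ := x
    have ha : a = s := h3 (a, b, τ) (by simp)
    have hτ : t0 ≤ τ := h4 (a, b, τ) (by simp)
    subst ha
    rw [List.isChain_cons] at h2
    obtain ⟨pos, p1, p2, p3⟩ := ih b (τ + 1) (fun x hx => h1 x (by simp [hx])) h2.2
      (fun y hy => (h2.1 y hy).1) (fun y hy => (h2.1 y hy).2)
    refine ⟨fun t => if t ≤ τ then a else pos t, by simp [hτ], ?_, ?_⟩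
    · intro t ht
      rcases lt_trichotomy t τ with h | h | h
      · left
        simp [h.le, Nat.succ_le_of_lt h]
      · right
        subst h
        simp only [le_refl, if_true, Nat.not_succ_le_self, if_false, p1]
        exact h1 (a, b, t) (by simp)
      · simp only [show ¬ t + 1 ≤ τ by omega, show ¬ t ≤ τ by omega, if_false]
        exact p2 t (by omega)
    · intro x hx
      rcases List.mem_cons.1 hx with rfl | hx
      · simp [p1, hτ]
      · have := p3 x hx
        have h5 := this.1
        simp only [show ¬ x.2.2 + 1 ≤ τ by omega, if_false]
        exact ⟨by omega, this.2⟩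

/-- Inductive description of timed trajectories together with a set of covered vertices. -/
inductive Tr (A : V → V → ℕ → Prop) : ℕ → V → ℕ → V → Set V → Prop
  | nil (t : ℕ) (u : V) (W : Set V) (h : W ⊆ {u}) : Tr A t u t u W
  | wait {t t' : ℕ} {u v : V} {W : Set V} (h : Tr A (t+1) u t' v W) : Tr A t u t' v W
  | move {t t' : ℕ} {u w v : V} {W W' : Set V} (a : A u w t) (h : Tr A (t+1) w t' v W)
      (hW : W' ⊆ W ∪ {u}) : Tr A t u t' v W'

lemma Tr.mono {A : V → V → ℕ → Prop} {t t' : ℕ} {u v : V} {W W' : Set V}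
    (h : Tr A t u t' v W) (hW : W' ⊆ W) : Tr A t u t' v W' := by
  induction h generalizing W' with
  | nil t u W h => exact .nil _ _ _ (hW.trans h)
  | wait h ih => exact .wait (ih hW)
  | move a h hW' ih => exact .move a h (hW.trans hW')

lemma Tr.trans {A : V → V → ℕ → Prop} {t t' t'' : ℕ} {u v w : V} {W W' : Set V}
    (h : Tr A t u t' v W) (h' : Tr A t' v t'' w W') (hu : v ∈ W') : Tr A t u t'' w (W ∪ W') := by
  induction h with
  | nil t u W h =>
    refine h'.mono (Set.union_subset (h.trans (by simpa using hu)) subset_rfl)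
  | wait h ih => exact .wait (ih h' hu)
  | move a h hW ih => 
    refine .move a (ih h' hu) ?_
    intro x hx
    rcases hx with hx | hx
    · rcases hW hx with hx | hx
      · exact Or.inl (Or.inl hx)
      · exact Or.inr hx
    · exact Or.inl (Or.inr hx)

/-- Adding the end vertex to the covered set. -/
lemma Tr.addEnd {A : V → V → ℕ → Prop} {t t' : ℕ} {u v : V} {W : Set V}
    (h : Tr A t u t' v W) : Tr A t u t' v (W ∪ {v}) := by
  induction h with
  | nil t u W h => exact .nil _ _ _ (Set.union_subset h subset_rfl)
  | wait h ih => exact .wait ih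
  | move a h hW ih =>
    refine .move a ih ?_
    intro x hx
    rcases hx with hx | hx
    · rcases hW hx with hx | hx
      · exact Or.inl (Or.inl hx)
      · exact Or.inr hx
    · exact Or.inl (Or.inr hx)

lemma Tr.comp {A : V → V → ℕ → Prop} {t t' t'' : ℕ} {u v w : V} {W W' : Set V}
    (h : Tr A t u t' v W) (h' : Tr A t' v t'' w W') : Tr A t u t'' w (W ∪ W') := by
  have : Tr A t' v t'' w (W' ∪ {v}) := by
    cases h' with
    | nil _ _ _ h => exact .nil _ _ _ (Set.union_subset h subset_rfl)
    | wait h => 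
      clear * - h
      refine .wait ?_
      generalize t' + 1 = s at h
      induction h with
      | nil t u W h => exact .nil _ _ _ (Set.union_subset h subset_rfl)
      | wait h ih => exact .wait ih
      | move a h hW ih => exact .move a h (Set.union_subset hW Set.subset_union_right)
    | move a h hW => exact .move a h (Set.union_subset hW Set.subset_union_right)
  exact (h.trans this (by simp)).mono (by intro x hx; rcases hx with hx | hx <;> simp [hx])

lemma Tr.waits {A : V → V → ℕ → Prop} (t d : ℕ) (u : V) : Tr A t u (t + d) u ∅ := by
  induction d generalizing t with
  | zero => exact .nil _ _ _ (by simp)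
  | succ d ih => 
    refine .wait ?_
    have := ih (t+1)
    rwa [show t + 1 + d = t + (d + 1) by omega] at this

lemma Tr.one {A : V → V → ℕ → Prop} (t : ℕ) (u v : V) (h : A u v t) : Tr A t u (t + 1) v {u, v} :=
  .move h (.nil _ _ {v} subset_rfl) (by intro x; simp [or_comm])

lemma Tr.extend {A : V → V → ℕ → Prop} {t t' t'' : ℕ} {u v : V} {W : Set V}
    (h : Tr A t u t' v W) (ht : t' ≤ t'') : Tr A t u t'' v W := by
  obtain ⟨d, rfl⟩ := Nat.exists_eq_add_of_le ht
  exact (h.comp (Tr.waits t' d v)).mono (by simp)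

lemma Tr.journey {A : V → V → ℕ → Prop} {t t' : ℕ} {u v : V} {W : Set V}
    (h : Tr A t u t' v W) : ∃ J : List (Step V),
      (∀ x ∈ J, A x.1 x.2.1 x.2.2) ∧ J.IsChain Linked ∧ startsAt J u ∧ departsAfter J t ∧
      ∀ w ∈ W, visits J u w := by
  induction h with
  | nil t u W h => exact ⟨[], by simp, by simp, by simp [startsAt], by simp [departsAfter],
      fun w hw => Or.inl (h hw)⟩
  | wait h ih =>
    obtain ⟨J, h1, h2, h3, h4, h5⟩ := ih
    exact ⟨J, h1, h2, h3, fun x hx => by have := h4 x hx; omega, h5⟩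
  | @move t t' u w v W W' a h hW ih =>
    obtain ⟨J, h1, h2, h3, h4, h5⟩ := ih
    refine ⟨(u, w, t) :: J, ?_, ?_, ?_, ?_, ?_⟩
    · intro x hx
      rcases List.mem_cons.1 hx with rfl | hx
      · exact a
      · exact h1 x hx
    · rw [List.isChain_cons]
      exact ⟨fun y hy => ⟨h3 y hy, h4 y hy⟩, h2⟩
    · intro x hx; simp at hx; subst hx; rfl
    · intro x hx; simp at hx; subst hx; exact le_rfl
    · intro x hx
      rcases hW hx with hx | hx
      · rcases h5 x hx with h | ⟨y, hy, h⟩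
        · exact Or.inr ⟨(u, w, t), by simp, h.symm⟩
        · exact Or.inr ⟨y, by simp [hy], h⟩
      · exact Or.inl hx

lemma const_on (A : V → V → ℕ → Prop) (pos : ℕ → V)
    (hp : ∀ t, pos (t+1) = pos t ∨ A (pos t) (pos (t+1)) t) (w : V) (a b : ℕ) (hab : a ≤ b)
    (h : ∀ t, a ≤ t → t < b → ∀ u v, A u v t → u ≠ w ∧ v ≠ w) : pos a = w ↔ pos b = w := by
  induction b, hab using Nat.le_induction with
  | base => rfl
  | succ b hab ih =>
    rw [ih (fun t h1 h2 => h t h1 (by omega))]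
    rcases hp b with h1 | h1
    · rw [h1]
    · have := h b hab (by omega) _ _ h1
      tauto

/-- First entrance into a vertex. -/
lemma enter (A : V → V → ℕ → Prop) (pos : ℕ → V)
    (hp : ∀ t, pos (t+1) = pos t ∨ A (pos t) (pos (t+1)) t) (w : V) (b : ℕ) (h0 : pos 0 ≠ w)
    (hb : pos b = w) : ∃ t, t < b ∧ pos (t+1) = w ∧ pos t ≠ w ∧ A (pos t) w t := by
  induction b with
  | zero => exact absurd hb h0
  | succ b ih =>
    by_cases h : pos b = w
    · obtain ⟨t, h1, h2⟩ := ih h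
      exact ⟨t, by omega, h2⟩
    · refine ⟨b, by omega, hb, h, ?_⟩
      rcases hp b with h1 | h1
      · exact absurd (h1 ▸ hb) h
      · rwa [hb] at h1

end Gen

variable {m n : ℕ}

def se (a b u v : CV m n) : Prop := (u = a ∧ v = b) ∨ (v = a ∧ u = b)
def bE (u v : CV m n) : Prop := backE u v ∨ backE v u

lemma avail_iff (S : Fin n → Finset (Fin m)) (k : ℕ) (u v : CV m n) (t : ℕ) :
    (𝒢 S k).avail u v t ↔
      (t < m + n ∧ bE u v) ∨
      (∃ i : Fin n, ∃ r, t = m + n + i.val * (4 * m + n + 2) + r ∧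
        (((r = 0 ∨ r = 3 * m + 1) ∧ (bE u v ∨ se (bb (attach (pIdx i))) (pt (pIdx i)) u v)) ∨
         ((1 ≤ r ∧ r ≤ 3 * m) ∧ (bE u v ∨ ∃ j ∈ S i, se (bb (eAt j)) (elt j) u v)) ∨
         ((3 * m + 2 ≤ r ∧ r < 4 * m + n + 2) ∧ bE u v))) ∨
      (∃ r, t = m + n + n * (4 * m + n + 2) + r ∧
        ((r < 2 ∧ se (bb (attach 0)) (pt 0) u v) ∨
         ((2 ≤ r ∧ r < m + n + 4 + 2 * k) ∧
           (bE u v ∨ ∃ i : Fin (n + 2), 1 ≤ i.val ∧ se (bb (attach i)) (pt i) u v)))) := by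
  have hL : ∀ i : Fin n, (([(passR i, 1), (takeR (S i), 3 * m), (passR i, 1), (backR, m + n)] :
      List ((CV m n → CV m n → ℕ → Prop) × ℕ)).map Prod.snd).sum = 4 * m + n + 2 := by
    intro i; simp; omega
  have hpass : ∀ i : Fin n, ∀ t, passR i u v t ↔ (bE u v ∨ se (bb (attach (pIdx i))) (pt (pIdx i)) u v) := by
    intro i t; simp only [passR, sym, bE, se]; tauto
  have htake : ∀ i : Fin n, ∀ t, takeR (S i) u v t ↔ (bE u v ∨ ∃ j ∈ S i, se (bb (eAt j)) (elt j) u v) := by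
    intro i t; simp only [takeR, sym, bE, se]
    constructor
    · rintro ((h | ⟨j, h1, h2⟩) | (h | ⟨j, h1, h2⟩))
      · exact Or.inl (Or.inl h)
      · exact Or.inr ⟨j, h1, Or.inl h2⟩
      · exact Or.inl (Or.inr h)
      · exact Or.inr ⟨j, h1, Or.inr h2⟩
    · rintro ((h | h) | ⟨j, h1, h2 | h2⟩)
      · exact Or.inl (Or.inl h)
      · exact Or.inr (Or.inl h)
      · exact Or.inl (Or.inr ⟨j, h1, h2⟩)
      · exact Or.inr (Or.inr ⟨j, h1, h2⟩)
  have hfin : ∀ t, finishR u v t ↔ (bE u v ∨ ∃ i : Fin (n + 2), 1 ≤ i.val ∧ se (bb (attach i)) (pt i) u v) := by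
    intro t; simp only [finishR, sym, bE, se]
    constructor
    · rintro ((h | ⟨j, h1, h2⟩) | (h | ⟨j, h1, h2⟩))
      · exact Or.inl (Or.inl h)
      · exact Or.inr ⟨j, h1, Or.inl h2⟩
      · exact Or.inl (Or.inr h)
      · exact Or.inr ⟨j, h1, Or.inr h2⟩
    · rintro ((h | h) | ⟨j, h1, h2 | h2⟩)
      · exact Or.inl (Or.inl h)
      · exact Or.inr (Or.inl h)
      · exact Or.inl (Or.inr ⟨j, h1, h2⟩)
      · exact Or.inr (Or.inr ⟨j, h1, h2⟩)
  have hcheck : ∀ t, checkR u v t ↔ se (bb (attach 0)) (pt 0) u v := by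
    intro t; rfl
  have hback : ∀ t, backR u v t ↔ bE u v := by
    intro t; rfl
  change schedAvail (blocks S k) u v t ↔ _
  rw [blocks, sched_cons, hback]
  refine or_congr Iff.rfl ?_
  simp only [sched_append, sum_flat _ _ hL, sched_flat _ _ hL, sched_cons, hpass, htake, hfin, hcheck, hback,
    List.length_finRange, List.getElem_finRange]
  simp only [schedAvail, and_false, exists_false, or_false]
  constructor
  · rintro ⟨t', rfl, ⟨q, r, hq, rfl, h⟩ | ⟨t'', rfl, h⟩⟩
    · left
      refine ⟨⟨q, hq⟩, r, by simp only []; omega, ?_⟩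
      rcases h with ⟨h, h'⟩ | ⟨_, rfl, ⟨h, h'⟩ | ⟨_, rfl, ⟨h, h'⟩ | ⟨_, rfl, ⟨h, h'⟩⟩⟩⟩
      · exact Or.inl ⟨by omega, h'⟩
      · exact Or.inr (Or.inl ⟨by omega, h'⟩)
      · exact Or.inl ⟨by omega, h'⟩
      · exact Or.inr (Or.inr ⟨by omega, h'⟩)
    · right
      refine ⟨t'', by omega, ?_⟩
      rcases h with h | ⟨_, rfl, h, h'⟩
      · exact Or.inl h
      · exact Or.inr ⟨by omega, h'⟩
  · rintro (⟨i, r, rfl, h⟩ | ⟨r, rfl, h⟩)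
    · refine ⟨i.val * (4 * m + n + 2) + r, by omega, Or.inl ⟨i.val, r, i.isLt, rfl, ?_⟩⟩
      rcases h with ⟨h | h, h'⟩ | ⟨h, h'⟩ | ⟨h, h'⟩
      · exact Or.inl ⟨by omega, h'⟩
      · exact Or.inr ⟨r - 1, by omega, Or.inr ⟨r - 1 - 3 * m, by omega, Or.inl ⟨by omega, h'⟩⟩⟩
      · exact Or.inr ⟨r - 1, by omega, Or.inl ⟨by omega, h'⟩⟩
      · exact Or.inr ⟨r - 1, by omega, Or.inr ⟨r - 1 - 3 * m, by omega, Or.inr ⟨r - 1 - 3 * m - 1, by omega, by omega, h'⟩⟩⟩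
    · refine ⟨n * (4 * m + n + 2) + r, by omega, Or.inr ⟨r, rfl, ?_⟩⟩
      rcases h with h | ⟨h, h'⟩
      · exact Or.inl h
      · exact Or.inr ⟨r - 2, by omega, by omega, h'⟩

lemma D_eq (S : Fin n → Finset (Fin m)) (k : ℕ) :
    D S k = m + n + n * (4 * m + n + 2) + (m + n + 4 + 2 * k) := by
  have hL : ∀ i : Fin n, (([(passR i, 1), (takeR (S i), 3 * m), (passR i, 1), (backR, m + n)] :
      List ((CV m n → CV m n → ℕ → Prop) × ℕ)).map Prod.snd).sum = 4 * m + n + 2 := by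
    intro i; simp; omega
  rw [D, blocks, List.map_cons, List.sum_cons, List.map_append, List.sum_append, sum_flat _ _ hL,
    List.length_finRange]
  simp
  omega

lemma hz (m n : ℕ) : 0 < m + n + 2 := by omega

lemma bE_tooth {u v : CV m n} (h : bE u v) : (∃ i, u = bb i) ∧ ∃ j, v = bb j := by
  rcases h with ⟨i, j, _, rfl, rfl⟩ | ⟨i, j, _, rfl, rfl⟩ <;> exact ⟨⟨_, rfl⟩, ⟨_, rfl⟩⟩

lemma bb_ne_elt (i : Fin (m+n+2)) (j : Fin m) : (bb i : CV m n) ≠ elt j := by simp [bb, elt]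
lemma bb_ne_pt (i : Fin (m+n+2)) (j : Fin (n+2)) : (bb i : CV m n) ≠ pt j := by simp [bb, pt]
lemma elt_ne_pt (i : Fin m) (j : Fin (n+2)) : (elt i : CV m n) ≠ pt j := by simp [elt, pt]
lemma pt_inj {i j : Fin (n+2)} : (pt i : CV m n) = pt j ↔ i = j := by simp [pt]
lemma elt_inj {i j : Fin m} : (elt i : CV m n) = elt j ↔ i = j := by simp [elt]
lemma bb_inj {i j : Fin (m+n+2)} : (bb i : CV m n) = bb j ↔ i = j := by simp [bb]

lemma attach_zero : (attach (m := m) (0 : Fin (n+2))).val = 0 := by simp [attach]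
lemma attach_pIdx (i : Fin n) : (attach (m := m) (pIdx i)).val = m + i.val + 1 := by
  have := i.isLt
  simp [attach, pIdx, show i.val ≠ n by omega]; omega
lemma attach_last : (attach (m := m) (Fin.last (n+1))).val = m + n + 1 := by simp [attach]
lemma attach_le (i : Fin (n+2)) (h : i ≠ Fin.last (n+1)) : (attach (m := m) i).val ≤ m + n := by
  have : i.val ≠ n + 1 := fun h' => h (Fin.ext h')
  have := i.isLt
  simp only [attach]; split_ifs <;> simp <;> omega

lemma se_elt {i : Fin (m+n+2)} {j j' : Fin m} {u v : CV m n} (h : se (bb i) (elt j) u v)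
    (h' : u = elt j' ∨ v = elt j') : j = j' := by
  rcases h with ⟨rfl, rfl⟩ | ⟨rfl, rfl⟩ <;> rcases h' with h' | h' <;>
    first | exact elt_inj.1 h' | exact absurd h' (bb_ne_elt _ _)

lemma se_pt {i : Fin (m+n+2)} {j j' : Fin (n+2)} {u v : CV m n} (h : se (bb i) (pt j) u v)
    (h' : u = pt j' ∨ v = pt j') : j = j' := by
  rcases h with ⟨rfl, rfl⟩ | ⟨rfl, rfl⟩ <;> rcases h' with h' | h' <;>
    first | exact pt_inj.1 h' | exact absurd h' (bb_ne_pt _ _)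

lemma se_pt_elt {i : Fin (m+n+2)} {j : Fin (n+2)} {j' : Fin m} {u v : CV m n} (h : se (bb i) (pt j) u v)
    (h' : u = elt j' ∨ v = elt j') : False := by
  rcases h with ⟨rfl, rfl⟩ | ⟨rfl, rfl⟩ <;> rcases h' with h' | h' <;>
    first | exact bb_ne_elt _ _ h' | exact elt_ne_pt _ _ h'.symm

lemma se_elt_pt {i : Fin (m+n+2)} {j : Fin m} {j' : Fin (n+2)} {u v : CV m n} (h : se (bb i) (elt j) u v)
    (h' : u = pt j' ∨ v = pt j') : False := by
  rcases h with ⟨rfl, rfl⟩ | ⟨rfl, rfl⟩ <;> rcases h' with h' | h' <;>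
    first | exact bb_ne_pt _ _ h' | exact elt_ne_pt _ _ h'

lemma bE_pt {j : Fin (n+2)} {u v : CV m n} (h : bE u v) (h' : u = pt j ∨ v = pt j) : False := by
  obtain ⟨⟨i, rfl⟩, ⟨i', rfl⟩⟩ := bE_tooth h
  rcases h' with h' | h' <;> exact bb_ne_pt _ _ h'

lemma bE_elt {j : Fin m} {u v : CV m n} (h : bE u v) (h' : u = elt j ∨ v = elt j) : False := by
  obtain ⟨⟨i, rfl⟩, ⟨i', rfl⟩⟩ := bE_tooth h
  rcases h' with h' | h' <;> exact bb_ne_elt _ _ h'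

lemma avail_elt {S : Fin n → Finset (Fin m)} {k : ℕ} {u v : CV m n} {t : ℕ} {j : Fin m}
    (h : (𝒢 S k).avail u v t) (h' : u = elt j ∨ v = elt j) :
    ∃ i : Fin n, j ∈ S i ∧ ∃ r, t = m + n + i.val * (4 * m + n + 2) + r ∧ 1 ≤ r ∧ r ≤ 3 * m := by
  rw [avail_iff] at h
  rcases h with ⟨_, h⟩ | ⟨i, r, rfl, ⟨_, h | h⟩ | ⟨hr, h | ⟨j', hj, h⟩⟩ | ⟨_, h⟩⟩ |
    ⟨r, rfl, ⟨_, h⟩ | ⟨_, h | ⟨_, _, h⟩⟩⟩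
  · exact (bE_elt h h').elim
  · exact (bE_elt h h').elim
  · exact (se_pt_elt h h').elim
  · exact (bE_elt h h').elim
  · exact ⟨i, se_elt h h' ▸ hj, r, rfl, hr⟩
  · exact (bE_elt h h').elim
  · exact (se_pt_elt h h').elim
  · exact (bE_elt h h').elim
  · exact (se_pt_elt h h').elim

lemma avail_pt {S : Fin n → Finset (Fin m)} {k : ℕ} {u v : CV m n} {t : ℕ} {j : Fin (n+2)}
    (h : (𝒢 S k).avail u v t) (h' : u = pt j ∨ v = pt j) :
    (∃ i : Fin n, j = pIdx i ∧ (t = m + n + i.val * (4 * m + n + 2) ∨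
      t = m + n + i.val * (4 * m + n + 2) + 3 * m + 1)) ∨
    (j = 0 ∧ (t = m + n + n * (4 * m + n + 2) ∨ t = m + n + n * (4 * m + n + 2) + 1) ∧
      se (bb (attach 0)) (pt 0) u v) ∨
    (1 ≤ j.val ∧ m + n + n * (4 * m + n + 2) + 2 ≤ t) := by
  rw [avail_iff] at h
  rcases h with ⟨_, h⟩ | ⟨i, r, rfl, ⟨hr, h | h⟩ | ⟨hr, h | ⟨j', hj, h⟩⟩ | ⟨_, h⟩⟩ |
    ⟨r, rfl, ⟨hr, h⟩ | ⟨hr, h | ⟨i, hi, h⟩⟩⟩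
  · exact (bE_pt h h').elim
  · exact (bE_pt h h').elim
  · left
    exact ⟨i, (se_pt h h').symm, by omega⟩
  · exact (bE_pt h h').elim
  · exact (se_elt_pt h h').elim
  · exact (bE_pt h h').elim
  · right; left
    exact ⟨(se_pt h h').symm, by omega, h⟩
  · exact (bE_pt h h').elim
  · right; right
    exact ⟨se_pt h h' ▸ hi, by omega⟩

lemma phase_le (i : Fin n) : i.val * (4 * m + n + 2) + (4 * m + n + 2) ≤ n * (4 * m + n + 2) := by
  have := i.isLt
  calc _ = (i.val + 1) * (4 * m + n + 2) := by ring
    _ ≤ _ := Nat.mul_le_mul_right _ this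

lemma avail_lt {S : Fin n → Finset (Fin m)} {k : ℕ} {u v : CV m n} {t : ℕ}
    (h : (𝒢 S k).avail u v t) : t < D S k := by
  rw [D_eq]
  rw [avail_iff] at h
  rcases h with ⟨_, h⟩ | ⟨i, r, rfl, h⟩ | ⟨r, rfl, h⟩
  · omega
  · have := phase_le (m := m) i
    rcases h with h | h | h <;> omega
  · rcases h with h | h <;> omega

lemma avail_finish {S : Fin n → Finset (Fin m)} {k : ℕ} {u v : CV m n} {d : ℕ}
    (h : (𝒢 S k).avail u v (m + n + n * (4 * m + n + 2) + 2 + d)) :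
    bE u v ∨ ∃ i : Fin (n + 2), 1 ≤ i.val ∧ se (bb (attach i)) (pt i) u v := by
  rw [avail_iff] at h
  rcases h with ⟨_, h⟩ | ⟨i, r, hr, h⟩ | ⟨r, hr, h⟩
  · omega
  · have := phase_le (m := m) i
    rcases h with h | h | h <;> omega
  · rcases h with h | h
    · omega
    · exact h.2

lemma finish_inv (S : Fin n → Finset (Fin m)) (k : ℕ) (pos : ℕ → CV m n)
    (hp : ∀ t, pos (t+1) = pos t ∨ (𝒢 S k).avail (pos t) (pos (t+1)) t)
    (C : ℕ) (hC : C = m + n + n * (4 * m + n + 2) + 2)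
    (h0 : pos C = bb ⟨0, hz m n⟩) (d : ℕ) (A : Finset (Fin (n+2)))
    (hA : ∀ i ∈ A, ∃ d' ≤ d, pos (C + d') = pt i) :
    (∃ x : Fin (m+n+2), pos (C + d) = bb x ∧ x.val + 2 * A.card ≤ d ∧
      (Fin.last (n+1) ∈ A → m + n + 1 + 2 * A.card ≤ d ∧
        (x.val ≤ m + n → m + n + 2 + 2 * A.card ≤ d))) ∨
    (∃ i : Fin (n+2), pos (C + d) = pt i ∧ (attach (m := m) i).val + 2 * A.card ≤ d + 1 ∧
      (Fin.last (n+1) ∈ A → i ≠ Fin.last (n+1) → m + n + 1 + 2 * A.card ≤ d)) := by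
  induction d generalizing A with
  | zero =>
    left
    have : A = ∅ := by
      by_contra h
      obtain ⟨i, hi⟩ := Finset.nonempty_iff_ne_empty.2 h
      obtain ⟨d', h1, h2⟩ := hA i hi
      obtain rfl : d' = 0 := by omega
      rw [Nat.add_zero, h0] at h2
      exact bb_ne_pt _ _ h2
    subst this
    exact ⟨_, h0, by simp, by simp⟩
  | succ d ih =>
    have red : ∀ B ⊆ A, (∀ i ∈ B, pos (C + (d+1)) = pt i → pos (C + d) = pt i) →
        ∀ i ∈ B, ∃ d' ≤ d, pos (C + d') = pt i := by
      intro B hB hB' i hi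
      obtain ⟨d', h1, h2⟩ := hA i (hB hi)
      rcases Nat.lt_or_ge d' (d+1) with h3 | h3
      · exact ⟨d', by omega, h2⟩
      · obtain rfl : d' = d + 1 := by omega
        exact ⟨d, le_rfl, hB' i hi h2⟩
    rcases hp (C + d) with hs | hs
    · rw [show C + d + 1 = C + (d + 1) by omega] at hs
      rcases ih A (red A subset_rfl (fun i _ h => hs ▸ h)) with ⟨x, h1, h2, h3⟩ | ⟨i, h1, h2, h3⟩
      · refine Or.inl ⟨x, hs.trans h1, by omega, fun h => ⟨?_, fun h' => ?_⟩⟩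
        · have := (h3 h).1; omega
        · have := (h3 h).2 h'; omega
      · refine Or.inr ⟨i, hs.trans h1, by omega, fun h h' => ?_⟩
        have := h3 h h'; omega
    · have hs' := hs
      rw [hC] at hs'
      have hf := avail_finish hs'
      rw [← hC, show C + d + 1 = C + (d + 1) by omega] at hf
      clear hs hs'
      rcases hf with hf | ⟨i, hi, hf | hf⟩
      · -- backbone move
        obtain ⟨⟨a, ha⟩, ⟨b, hb⟩⟩ := bE_tooth hf
        have hab : b.val ≤ a.val + 1 ∧ a.val ≤ b.val + 1 := by
          rcases hf with ⟨i, j, hij, h1, h2⟩ | ⟨i, j, hij, h1, h2⟩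
          · rw [ha] at h1; rw [hb] at h2
            rw [bb_inj] at h1 h2; subst h1; subst h2; omega
          · rw [ha] at h2; rw [hb] at h1
            rw [bb_inj] at h1 h2; subst h1; subst h2; omega
        left
        refine ⟨b, hb, ?_⟩
        rcases ih A (red A subset_rfl (fun i _ h => absurd (hb.symm.trans h) (bb_ne_pt _ _)))
          with ⟨x, h1, h2, h3⟩ | ⟨i, h1, h2, h3⟩
        · rw [ha, bb_inj] at h1
          subst h1
          refine ⟨by omega, fun h => ⟨?_, fun h' => ?_⟩⟩
          · have := (h3 h).1; omega
          · have := (h3 h).1; omega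
        · exact absurd (ha.symm.trans h1) (bb_ne_pt _ _)
      · -- entering a tooth
        obtain ⟨ha, hb⟩ := hf
        right
        refine ⟨i, hb, ?_⟩
        have hcard : A.card ≤ (A.erase i).card + 1 := by
          have := Finset.pred_card_le_card_erase (s := A) (a := i); omega
        rcases ih (A.erase i) (red _ (Finset.erase_subset _ _) (fun i' hi' h => by
            rw [hb, pt_inj] at h
            exact absurd h.symm (Finset.ne_of_mem_erase hi')))
          with ⟨x, h1, h2, h3⟩ | ⟨i, h1, h2, h3⟩
        · rw [ha, bb_inj] at h1
          subst h1
          refine ⟨by omega, fun h h' => ?_⟩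
          have := (h3 (Finset.mem_erase.2 ⟨h'.symm, h⟩)).2 (attach_le i h')
          omega
        · exact absurd (ha.symm.trans h1) (bb_ne_pt _ _)
      · -- leaving a tooth
        obtain ⟨hb, ha⟩ := hf
        left
        refine ⟨_, hb, ?_⟩
        rcases ih A (red A subset_rfl (fun i _ h => absurd (hb.symm.trans h) (bb_ne_pt _ _)))
          with ⟨x, h1, h2, h3⟩ | ⟨i', h1, h2, h3⟩
        · exact absurd (h1.symm.trans ha) (bb_ne_pt _ _)
        · rw [ha, pt_inj] at h1
          subst h1
          refine ⟨by omega, fun h => ?_⟩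
          by_cases hl : i = Fin.last (n+1)
          · have := attach_last (m := m) (n := n)
            rw [← hl] at this
            refine ⟨by omega, by omega⟩
          · have := h3 h hl
            omega

lemma pIdx_inj : Function.Injective (pIdx (n := n)) := by
  intro i j h
  simp [pIdx] at h
  exact Fin.ext h

lemma forward (S : Fin n → Finset (Fin m)) (k : ℕ) (pos : ℕ → CV m n)
    (hp : ∀ t, pos (t+1) = pos t ∨ (𝒢 S k).avail (pos t) (pos (t+1)) t)
    (h0 : pos 0 = bb ⟨0, hz m n⟩) (hv : ∀ v, ∃ t ≤ D S k, pos t = v) :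
    ∃ I : Finset (Fin n), I.card ≤ k ∧ ∀ j : Fin m, ∃ i ∈ I, j ∈ S i := by
  classical
  obtain ⟨C, hC⟩ : ∃ C, C = m + n + n * (4 * m + n + 2) := ⟨_, rfl⟩
  have hD := D_eq S k
  rw [← hC] at hD
  have hlast0 : (Fin.last (n+1)) ≠ 0 := by simp [Fin.ext_iff]
  have hlastp : ∀ i : Fin n, Fin.last (n+1) ≠ pIdx i := by
    intro i h; have := i.isLt; simp [Fin.ext_iff, pIdx] at h; omega
  have hp0 : ∀ i : Fin n, (0 : Fin (n+2)) ≠ pIdx i := by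
    intro i h; simp [Fin.ext_iff, pIdx] at h
  -- the last tooth is not visited before `C + 2`
  have hlast : ∀ t ≤ C + 2, pos t ≠ pt (Fin.last (n+1)) := by
    intro t ht h
    rw [← const_on _ pos hp _ 0 t (by omega), h0] at h
    · exact bb_ne_pt _ _ h
    · intro s _ hs u v huv
      by_contra hcon
      rcases avail_pt huv (j := Fin.last (n+1)) (by tauto) with ⟨i, h1, _⟩ | ⟨h1, _⟩ | ⟨_, h1⟩
      · exact hlastp i h1
      · exact hlast0 h1
      · omega
  -- not on p_0 at C+2
  have hnot0 : pos (C + 2) ≠ pt 0 := by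
    intro h
    obtain ⟨t, ht, hpt⟩ := hv (pt (Fin.last (n+1)))
    have ht2 : C + 2 ≤ t := by
      by_contra hcon
      exact hlast t (by omega) hpt
    rw [const_on _ pos hp _ (C+2) t ht2, hpt, pt_inj] at h
    · exact hlast0 h
    · intro s hs _ u v huv
      by_contra hcon
      rcases avail_pt huv (j := 0) (by tauto) with ⟨i, h1, _⟩ | ⟨_, h1, _⟩ | ⟨h1, _⟩
      · exact hp0 i h1
      · omega
      · simp at h1
  have hb : pos (C + 2) = bb ⟨0, hz m n⟩ := by
    obtain ⟨t, ht, hpt⟩ := hv (pt 0)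
    obtain ⟨s, _, h1, h2, h3⟩ := enter _ pos hp _ t (by rw [h0]; exact bb_ne_pt _ _) hpt
    have hs : s = C := by
      rcases avail_pt h3 (j := 0) (Or.inr rfl) with ⟨i, h1, _⟩ | ⟨_, h4, _⟩ | ⟨h1, _⟩
      · exact absurd h1 (hp0 i)
      · rcases h4 with h4 | h4
        · omega
        · obtain rfl : s = C + 1 := by omega
          exact absurd h1 hnot0
      · simp at h1
    subst hs
    rcases hp (s + 1) with h4 | h4
    · exact absurd (h4.trans h1) hnot0
    · rw [h1] at h4
      rcases avail_pt h4 (j := 0) (Or.inl rfl) with ⟨i, h1, _⟩ | ⟨_, _, h5⟩ | ⟨h1, _⟩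
      · exact absurd h1 (hp0 i)
      · rcases h5 with ⟨h5, _⟩ | ⟨h5, _⟩
        · exact absurd h5.symm (bb_ne_pt _ _)
        · rw [h5, bb_inj]
          exact Fin.ext attach_zero
      · simp at h1
  refine ⟨Finset.univ.filter (fun i => ∀ t ≤ C + 2, pos t ≠ pt (pIdx i)), ?_, ?_⟩
  · set I := Finset.univ.filter (fun i => ∀ t ≤ C + 2, pos t ≠ pt (pIdx i)) with hI
    let A : Finset (Fin (n+2)) := insert (Fin.last (n+1)) (I.image pIdx)
    have hcard : A.card = I.card + 1 := by
      rw [Finset.card_insert_of_notMem, Finset.card_image_of_injective _ pIdx_inj]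
      intro h
      obtain ⟨i, _, hi⟩ := Finset.mem_image.1 h
      exact hlastp i hi.symm
    have hA : ∀ i ∈ A, ∃ d' ≤ m + n + 2 + 2 * k, pos (C + 2 + d') = pt i := by
      intro i hi
      obtain ⟨t, ht, hpt⟩ := hv (pt i)
      have ht2 : C + 2 ≤ t := by
        by_contra hcon
        rcases Finset.mem_insert.1 hi with rfl | hi
        · exact hlast t (by omega) hpt
        · obtain ⟨i', hi', rfl⟩ := Finset.mem_image.1 hi
          exact (Finset.mem_filter.1 hi').2 t (by omega) hpt
      exact ⟨t - (C + 2), by omega, by rw [show C + 2 + (t - (C + 2)) = t by omega]; exact hpt⟩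
    have hlA : Fin.last (n+1) ∈ A := Finset.mem_insert_self _ _
    rcases finish_inv S k pos hp (C + 2) (by omega) hb (m + n + 2 + 2 * k) A hA with
      ⟨x, _, _, h⟩ | ⟨i, _, h2, h3⟩
    · have := (h hlA).1
      omega
    · by_cases hl : i = Fin.last (n+1)
      · subst hl
        rw [attach_last] at h2
        omega
      · have := h3 hlA hl
        omega
  · intro j
    obtain ⟨t, ht, hpt⟩ := hv (elt j)
    obtain ⟨s, _, h1, h2, h3⟩ := enter _ pos hp _ t (by rw [h0]; exact bb_ne_elt _ _) hpt
    obtain ⟨i, hj, r, hr, hr1, hr2⟩ := avail_elt h3 (Or.inr rfl)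
    refine ⟨i, ?_, hj⟩
    rw [Finset.mem_filter]
    refine ⟨Finset.mem_univ _, fun t' ht' hpt' => ?_⟩
    have hph := phase_le (m := m) i
    obtain ⟨T, hT⟩ : ∃ T, T = m + n + i.val * (4 * m + n + 2) := ⟨_, rfl⟩
    have key : ∀ a b, a ≤ b → b ≤ C + 2 → (∀ t, a ≤ t → t < b → t ≠ T ∧ t ≠ T + 3 * m + 1) →
        (pos a = pt (pIdx i) ↔ pos b = pt (pIdx i)) := by
      intro a b hab hb2 hne
      refine const_on _ pos hp _ a b hab ?_
      intro q hq1 hq2 u v huv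
      by_contra hcon
      have := hne q hq1 hq2
      rcases avail_pt huv (j := pIdx i) (by tauto) with ⟨i', h1, h4⟩ | ⟨h1, _⟩ | ⟨_, h1⟩
      · have := pIdx_inj h1
        subst this
        omega
      · exact hp0 i h1.symm
      · omega
    rcases Nat.lt_or_ge T t' with c1 | c1
    · rcases Nat.lt_or_ge (T + 3 * m + 1) t' with c2 | c2
      · rw [key t' (C + 2) ht' le_rfl (by intro t _ _; omega), hb] at hpt'
        exact bb_ne_pt _ _ hpt'
      · have : pos (s + 1) = pt (pIdx i) := by
          rcases le_total t' (s+1) with c3 | c3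
          · exact (key t' (s+1) c3 (by omega) (by intro t _ _; omega)).1 hpt'
          · exact (key (s+1) t' c3 (by omega) (by intro t _ _; omega)).2 hpt'
        rw [h1] at this
        exact elt_ne_pt _ _ this
    · rw [← key 0 t' (by omega) ht' (by intro t _ _; omega), h0] at hpt'
      exact bb_ne_pt _ _ hpt'

def AA (S : Fin n → Finset (Fin m)) (k : ℕ) : CV m n → CV m n → ℕ → Prop :=
  fun u v t => (𝒢 S k).G.Adj u v ∧ (𝒢 S k).avail u v t

/-- The time at which the check block starts. -/
def Ct (m n : ℕ) : ℕ := m + n + n * (4 * m + n + 2)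

lemma adj_back {S : Fin n → Finset (Fin m)} {k : ℕ} {u v : CV m n} (h : bE u v) :
    (𝒢 S k).G.Adj u v := by
  change (combG m n).Adj u v
  rw [combG, SimpleGraph.fromRel_adj]
  refine ⟨?_, ?_⟩
  · rcases h with ⟨i, j, h, rfl, rfl⟩ | ⟨i, j, h, rfl, rfl⟩ <;>
      (intro h'; rw [bb_inj] at h'; subst h'; omega)
  · rcases h with h | h
    · exact Or.inl (Or.inl h)
    · exact Or.inr (Or.inl h)

lemma adj_elt {S : Fin n → Finset (Fin m)} {k : ℕ} (j : Fin m) :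
    (𝒢 S k).G.Adj (bb (eAt j)) (elt j) := by
  change (combG m n).Adj _ _
  rw [combG, SimpleGraph.fromRel_adj]
  exact ⟨bb_ne_elt _ _, Or.inl (Or.inr (Or.inl ⟨j, rfl, rfl⟩))⟩

lemma adj_pt {S : Fin n → Finset (Fin m)} {k : ℕ} (j : Fin (n+2)) :
    (𝒢 S k).G.Adj (bb (attach j)) (pt j) := by
  change (combG m n).Adj _ _
  rw [combG, SimpleGraph.fromRel_adj]
  exact ⟨bb_ne_pt _ _, Or.inl (Or.inr (Or.inr ⟨j, rfl, rfl⟩))⟩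

lemma back_move (S : Fin n → Finset (Fin m)) (k : ℕ) {u v : CV m n} (h : bE u v) (t : ℕ)
    (h1 : t < Ct m n ∨ (Ct m n + 2 ≤ t ∧ t < Ct m n + (m + n + 4 + 2 * k))) : AA S k u v t := by
  refine ⟨adj_back h, ?_⟩
  rw [avail_iff]
  rw [Ct] at h1
  rcases h1 with h1 | h1
  · rcases Nat.lt_or_ge t (m + n) with h2 | h2
    · exact Or.inl ⟨h2, h⟩
    · right; left
      have hL : 0 < 4 * m + n + 2 := by omega
      have hdm := Nat.div_add_mod' (t - (m + n)) (4 * m + n + 2)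
      have hq : (t - (m + n)) / (4 * m + n + 2) < n := by
        rw [Nat.div_lt_iff_lt_mul hL]; omega
      have hr := Nat.mod_lt (t - (m + n)) hL
      refine ⟨⟨_, hq⟩, (t - (m + n)) % (4 * m + n + 2), by simp only []; omega, ?_⟩
      generalize (t - (m + n)) % (4 * m + n + 2) = r at hr
      by_cases c1 : r = 0 ∨ r = 3 * m + 1
      · exact Or.inl ⟨c1, Or.inl h⟩
      · by_cases c2 : r ≤ 3 * m
        · exact Or.inr (Or.inl ⟨by omega, Or.inl h⟩)
        · exact Or.inr (Or.inr ⟨by omega, h⟩)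
  · right; right
    exact ⟨t - (m + n + n * (4 * m + n + 2)), by omega, Or.inr ⟨by omega, Or.inl h⟩⟩

lemma se_refl (a b : CV m n) : se a b a b := Or.inl ⟨rfl, rfl⟩
lemma se_swap (a b : CV m n) : se a b b a := Or.inr ⟨rfl, rfl⟩

lemma elt_move (S : Fin n → Finset (Fin m)) (k : ℕ) (i : Fin n) (j : Fin m) (hj : j ∈ S i) (r : ℕ)
    (h1 : 1 ≤ r) (h2 : r ≤ 3 * m) :
    AA S k (bb (eAt j)) (elt j) (m + n + i.val * (4 * m + n + 2) + r) ∧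
    AA S k (elt j) (bb (eAt j)) (m + n + i.val * (4 * m + n + 2) + r) := by
  refine ⟨⟨adj_elt j, ?_⟩, ⟨(adj_elt j).symm, ?_⟩⟩ <;> rw [avail_iff]
  · exact Or.inr (Or.inl ⟨i, r, rfl, Or.inr (Or.inl ⟨⟨h1, h2⟩, Or.inr ⟨j, hj, se_refl _ _⟩⟩)⟩)
  · exact Or.inr (Or.inl ⟨i, r, rfl, Or.inr (Or.inl ⟨⟨h1, h2⟩, Or.inr ⟨j, hj, se_swap _ _⟩⟩)⟩)

lemma pass_move (S : Fin n → Finset (Fin m)) (k : ℕ) (i : Fin n) :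
    AA S k (bb (attach (pIdx i))) (pt (pIdx i)) (m + n + i.val * (4 * m + n + 2)) ∧
    AA S k (pt (pIdx i)) (bb (attach (pIdx i))) (m + n + i.val * (4 * m + n + 2) + (3 * m + 1)) := by
  refine ⟨⟨adj_pt _, ?_⟩, ⟨(adj_pt _).symm, ?_⟩⟩ <;> rw [avail_iff]
  · exact Or.inr (Or.inl ⟨i, 0, rfl, Or.inl ⟨by omega, Or.inr (se_refl _ _)⟩⟩)
  · exact Or.inr (Or.inl ⟨i, _, rfl, Or.inl ⟨by omega, Or.inr (se_swap _ _)⟩⟩)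

lemma check_move (S : Fin n → Finset (Fin m)) (k : ℕ) :
    AA S k (bb (attach 0)) (pt 0) (Ct m n) ∧ AA S k (pt 0) (bb (attach 0)) (Ct m n + 1) := by
  refine ⟨⟨adj_pt _, ?_⟩, ⟨(adj_pt _).symm, ?_⟩⟩ <;> rw [avail_iff]
  · exact Or.inr (Or.inr ⟨0, rfl, Or.inl ⟨by omega, se_refl _ _⟩⟩)
  · exact Or.inr (Or.inr ⟨1, rfl, Or.inl ⟨by omega, se_swap _ _⟩⟩)

lemma fin_move (S : Fin n → Finset (Fin m)) (k : ℕ) (i : Fin (n+2)) (hi : 1 ≤ i.val) (t : ℕ)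
    (h1 : Ct m n + 2 ≤ t) (h2 : t < Ct m n + (m + n + 4 + 2 * k)) :
    AA S k (bb (attach i)) (pt i) t ∧ AA S k (pt i) (bb (attach i)) t := by
  rw [Ct] at h1 h2
  refine ⟨⟨adj_pt _, ?_⟩, ⟨(adj_pt _).symm, ?_⟩⟩ <;> rw [avail_iff]
  · exact Or.inr (Or.inr ⟨t - (m + n + n * (4 * m + n + 2)), by omega,
      Or.inr ⟨by omega, Or.inr ⟨i, hi, se_refl _ _⟩⟩⟩)
  · exact Or.inr (Or.inr ⟨t - (m + n + n * (4 * m + n + 2)), by omega,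
      Or.inr ⟨by omega, Or.inr ⟨i, hi, se_swap _ _⟩⟩⟩)

lemma bE_up (x : ℕ) (h : x + 1 < m + n + 2) :
    bE (bb ⟨x, by omega⟩ : CV m n) (bb ⟨x + 1, h⟩) := Or.inl ⟨_, _, rfl, rfl, rfl⟩
lemma bE_down (x : ℕ) (h : x + 1 < m + n + 2) :
    bE (bb ⟨x + 1, h⟩ : CV m n) (bb ⟨x, by omega⟩) := Or.inr ⟨_, _, rfl, rfl, rfl⟩

lemma walkUp (S : Fin n → Finset (Fin m)) (k : ℕ) (t x d : ℕ) (hx : x + d < m + n + 2)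
    (h : t + d ≤ Ct m n ∨ (Ct m n + 2 ≤ t ∧ t + d ≤ Ct m n + (m + n + 4 + 2 * k))) :
    Tr (AA S k) t (bb ⟨x, by omega⟩) (t + d) (bb ⟨x + d, hx⟩)
      {v | ∃ y : Fin (m+n+2), x ≤ y.val ∧ y.val ≤ x + d ∧ v = bb y} := by
  induction d with
  | zero =>
    refine .nil _ _ _ ?_
    rintro v ⟨y, h1, h2, rfl⟩
    simp only [Set.mem_singleton_iff, bb_inj, Fin.ext_iff]
    omega
  | succ d ih =>
    have h1 := (ih (by omega) (by omega)).comp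
      (Tr.one _ _ _ (back_move S k (bE_up (x + d) hx) (t + d) (by omega)))
    refine h1.mono ?_
    rintro v ⟨y, h2, h3, rfl⟩
    by_cases h4 : y.val ≤ x + d
    · exact Or.inl ⟨y, h2, h4, rfl⟩
    · right; right
      simp only [Set.mem_singleton_iff, bb_inj, Fin.ext_iff]
      omega

lemma walkDown (S : Fin n → Finset (Fin m)) (k : ℕ) (t x d : ℕ) (hx : x + d < m + n + 2)
    (h : t + d ≤ Ct m n) :
    Tr (AA S k) t (bb ⟨x + d, hx⟩) (t + d) (bb ⟨x, by omega⟩) ∅ := by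
  induction d generalizing t with
  | zero => exact .nil _ _ _ (by simp)
  | succ d ih =>
    have h1 := (Tr.one _ _ _ (back_move S k (bE_down (x + d) hx) t (by omega))).comp
      (ih (t + 1) (by omega) (by omega))
    rw [show t + 1 + d = t + (d + 1) by omega] at h1
    exact h1.mono (by simp)

lemma walk (S : Fin n → Finset (Fin m)) (k : ℕ) (t : ℕ) (x y : Fin (m+n+2))
    (hx : x.val ≤ m + n) (hy : y.val ≤ m + n) (h : t + (m + n) ≤ Ct m n) :
    Tr (AA S k) t (bb x) (t + (m + n)) (bb y) ∅ := by
  rcases le_total x.val y.val with hxy | hxy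
  · obtain ⟨d, hd⟩ := Nat.exists_eq_add_of_le hxy
    have := walkUp S k t x.val d (by omega) (by omega)
    have e : (⟨x.val + d, by omega⟩ : Fin (m+n+2)) = y := Fin.ext hd.symm
    rw [e] at this
    exact (this.extend (by omega)).mono (by simp)
  · obtain ⟨d, hd⟩ := Nat.exists_eq_add_of_le hxy
    have := walkDown S k t y.val d (by omega) (by omega)
    have e : (⟨y.val + d, by omega⟩ : Fin (m+n+2)) = x := Fin.ext hd.symm
    rw [e] at this
    exact (this.extend (by omega)).mono (by simp)

lemma takeWalk (S : Fin n → Finset (Fin m)) (k : ℕ) (i : Fin n) (x : ℕ) (hx : x ≤ m) :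
    Tr (AA S k) (m + n + i.val * (4 * m + n + 2)) (bb ⟨0, hz m n⟩)
      (m + n + i.val * (4 * m + n + 2) + (1 + 3 * x)) (bb ⟨x, by omega⟩)
      {v | ∃ j ∈ S i, j.val < x ∧ v = elt j} := by
  have hph := phase_le (m := m) i
  have hCt : Ct m n = m + n + n * (4 * m + n + 2) := rfl
  induction x with
  | zero => exact (Tr.waits _ 1 _).mono (by rintro v ⟨j, _, h, _⟩; omega)
  | succ x ih =>
    have h1 := (ih (by omega)).comp (Tr.one _ _ _ (back_move S k (bE_up x (by omega)) _ (by omega)))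
    by_cases hj : (⟨x, hx⟩ : Fin m) ∈ S i
    · have e := elt_move S k i ⟨x, hx⟩ hj
      have h2 := (h1.comp (Tr.one _ _ _ (e (1 + 3 * x + 1) (by omega) (by omega)).1)).comp
        (Tr.one _ _ _ (e (1 + 3 * x + 1 + 1) (by omega) (by omega)).2)
      refine (h2.extend (t'' := m + n + i.val * (4 * m + n + 2) + (1 + 3 * (x + 1))) (by omega)).mono ?_
      rintro v ⟨j, h3, h4, rfl⟩
      by_cases h5 : j.val < x
      · exact Or.inl (Or.inl (Or.inl ⟨j, h3, h5, rfl⟩))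
      · obtain rfl : j = ⟨x, hx⟩ := Fin.ext (by simp only []; omega)
        exact Or.inr (Or.inl rfl)
    · refine (h1.extend (t'' := m + n + i.val * (4 * m + n + 2) + (1 + 3 * (x + 1))) (by omega)).mono ?_
      rintro v ⟨j, h3, h4, rfl⟩
      by_cases h5 : j.val < x
      · exact Or.inl ⟨j, h3, h5, rfl⟩
      · obtain rfl : j = ⟨x, hx⟩ := Fin.ext (by simp only []; omega)
        exact absurd h3 hj

lemma phases (S : Fin n → Finset (Fin m)) (k : ℕ) (I : Finset (Fin n)) (q : ℕ) (hq : q ≤ n) :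
    ∃ x : Fin (m+n+2), x.val ≤ m + n ∧
    Tr (AA S k) 0 (bb ⟨0, hz m n⟩) (q * (4 * m + n + 2)) (bb x)
      {v | ∃ i : Fin n, i.val < q ∧
        ((i ∈ I ∧ ∃ j ∈ S i, v = elt j) ∨ (i ∉ I ∧ v = pt (pIdx i)))} := by
  induction q with
  | zero => 
    refine ⟨⟨0, hz m n⟩, by simp, ?_⟩
    rw [Nat.zero_mul]
    exact .nil _ _ _ (by rintro v ⟨i, h, _⟩; omega)
  | succ q ih =>
    obtain ⟨x, hx, h1⟩ := ih (by omega)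
    let i : Fin n := ⟨q, hq⟩
    have hph := phase_le (m := m) i
    have hi : i.val = q := rfl
    have hCt : Ct m n = m + n + n * (4 * m + n + 2) := rfl
    have hmul : (q + 1) * (4 * m + n + 2) = q * (4 * m + n + 2) + (4 * m + n + 2) := by ring
    by_cases hI : i ∈ I
    · refine ⟨⟨m, by omega⟩, by simp, ?_⟩
      have h2 := h1.comp (walk S k (q * (4 * m + n + 2)) x ⟨0, hz m n⟩ hx (by simp) (by rw [hi] at hph; omega))
      rw [show q * (4 * m + n + 2) + (m + n) = m + n + i.val * (4 * m + n + 2) by rw [hi]; omega] at h2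
      have h3 := h2.comp (takeWalk S k i m le_rfl)
      refine (h3.extend (by rw [hi]; omega)).mono ?_
      rintro v ⟨i', h4, h5⟩
      by_cases h6 : i'.val < q
      · exact Or.inl (Or.inl ⟨i', h6, h5⟩)
      · obtain rfl : i' = i := Fin.ext (by omega)
        rcases h5 with ⟨_, j, hj, rfl⟩ | ⟨h5, _⟩
        · exact Or.inr ⟨j, hj, j.isLt, rfl⟩
        · exact absurd hI h5
    · have ha := attach_pIdx (m := m) i
      refine ⟨attach (pIdx i), by omega, ?_⟩
      have h2 := h1.comp (walk S k (q * (4 * m + n + 2)) x (attach (pIdx i)) hx (by omega) (by rw [hi] at hph; omega))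
      rw [show q * (4 * m + n + 2) + (m + n) = m + n + i.val * (4 * m + n + 2) by rw [hi]; omega] at h2
      have h3 := (h2.comp (Tr.one _ _ _ (pass_move S k i).1)).extend
        (t'' := m + n + i.val * (4 * m + n + 2) + (3 * m + 1)) (by omega)
      have h4 := h3.comp (Tr.one _ _ _ (pass_move S k i).2)
      refine (h4.extend (by rw [hi]; omega)).mono ?_
      rintro v ⟨i', h4, h5⟩
      by_cases h6 : i'.val < q
      · exact Or.inl (Or.inl (Or.inl ⟨i', h6, h5⟩))
      · obtain rfl : i' = i := Fin.ext (by omega)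
        rcases h5 with ⟨h5, _⟩ | ⟨_, rfl⟩
        · exact absurd h5 hI
        · exact Or.inr (Or.inl rfl)

lemma finishWalk (S : Fin n → Finset (Fin m)) (k : ℕ) (I : Finset (Fin n)) (hI : I.card ≤ k)
    (x : ℕ) (hx : x ≤ n) :
    Tr (AA S k) (Ct m n + 2) (bb ⟨0, hz m n⟩)
      (Ct m n + 2 + (m + x + 2 * (I.filter (fun i => i.val < x)).card)) (bb ⟨m + x, by omega⟩)
      {v | (∃ y : Fin (m+n+2), y.val ≤ m + x ∧ v = bb y) ∨
        (∃ i ∈ I, i.val < x ∧ v = pt (pIdx i))} := by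
  induction x with
  | zero =>
    have h := walkUp S k (Ct m n + 2) 0 m (by omega) (by omega)
    simp only [Nat.zero_add] at h
    refine (h.extend (by omega)).mono ?_
    rintro v (⟨y, h1, rfl⟩ | ⟨i, _, h1, _⟩)
    · exact ⟨y, by omega, by omega, rfl⟩
    · omega
  | succ x ih =>
    have hc : (I.filter (fun i => i.val < x)).card ≤ k := (Finset.card_filter_le _ _).trans hI
    have hc' : (I.filter (fun i => i.val < x + 1)).card ≤ k := (Finset.card_filter_le _ _).trans hI
    have h1 := (ih (by omega)).comp (Tr.one _ _ _ (back_move S k (bE_up (m + x) (by omega)) _ (by omega)))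
    let i : Fin n := ⟨x, hx⟩
    have hle : (I.filter (fun i => i.val < x)).card ≤ (I.filter (fun i => i.val < x + 1)).card := by
      apply Finset.card_le_card
      intro j hj
      simp only [Finset.mem_filter] at hj ⊢
      exact ⟨hj.1, by omega⟩
    by_cases hi : i ∈ I
    · have hlt : (I.filter (fun i => i.val < x)).card < (I.filter (fun i => i.val < x + 1)).card := by
        apply Finset.card_lt_card
        rw [Finset.ssubset_iff_of_subset]
        · exact ⟨i, by simp [hi, i], by simp [i]⟩
        · intro j hj
          simp only [Finset.mem_filter] at hj ⊢
          exact ⟨hj.1, by omega⟩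
      have e : (⟨m + x + 1, by omega⟩ : Fin (m+n+2)) = attach (pIdx i) := Fin.ext (attach_pIdx i).symm
      rw [e] at h1
      have h2 := (h1.comp (Tr.one _ _ _ (fin_move S k (pIdx i) (by simp [pIdx]) _ (by omega) (by omega)).1)).comp
        (Tr.one _ _ _ (fin_move S k (pIdx i) (by simp [pIdx]) _ (by omega) (by omega)).2)
      rw [← e] at h2
      refine (h2.extend (by omega)).mono ?_
      rintro v (⟨y, h3, rfl⟩ | ⟨i', h4, h5, rfl⟩)
      · by_cases h6 : y.val ≤ m + x
        · exact Or.inl (Or.inl (Or.inl (Or.inl ⟨y, h6, rfl⟩)))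
        · refine Or.inr (Or.inr ?_)
          simp only [Set.mem_singleton_iff, bb_inj, Fin.ext_iff]
          omega
      · by_cases h6 : i'.val < x
        · exact Or.inl (Or.inl (Or.inl (Or.inr ⟨i', h4, h6, rfl⟩)))
        · obtain rfl : i' = i := Fin.ext (by simp only [i]; omega)
          exact Or.inr (Or.inl rfl)
    · refine (h1.extend (by omega)).mono ?_
      rintro v (⟨y, h3, rfl⟩ | ⟨i', h4, h5, rfl⟩)
      · by_cases h6 : y.val ≤ m + x
        · exact Or.inl (Or.inl ⟨y, h6, rfl⟩)
        · refine Or.inr (Or.inr ?_)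
          simp only [Set.mem_singleton_iff, bb_inj, Fin.ext_iff]
          omega
      · by_cases h6 : i'.val < x
        · exact Or.inl (Or.inr ⟨i', h4, h6, rfl⟩)
        · obtain rfl : i' = i := Fin.ext (by simp only [i]; omega)
          exact absurd h4 hi

lemma backward (S : Fin n → Finset (Fin m)) (k : ℕ) (I : Finset (Fin n)) (hI : I.card ≤ k)
    (hcov : ∀ j : Fin m, ∃ i ∈ I, j ∈ S i) :
    ∃ t v, Tr (AA S k) 0 (bb ⟨0, hz m n⟩) t v Set.univ := by
  obtain ⟨x, hx, h1⟩ := phases S k I n le_rfl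
  have hCt : Ct m n = m + n + n * (4 * m + n + 2) := rfl
  have h2 := h1.comp (walk S k _ x ⟨0, hz m n⟩ hx (by simp) (by omega))
  rw [show n * (4 * m + n + 2) + (m + n) = Ct m n by omega] at h2
  have e0 : (⟨0, hz m n⟩ : Fin (m+n+2)) = attach 0 := Fin.ext attach_zero.symm
  have hcheck := (Tr.one _ _ _ (check_move S k).1).comp (Tr.one _ _ _ (check_move S k).2)
  rw [← e0] at hcheck
  have h3 := (h2.comp hcheck).comp (finishWalk S k I hI n le_rfl)
  have hc : (I.filter (fun i => i.val < n)).card ≤ k := (Finset.card_filter_le _ _).trans hI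
  have h4 := h3.comp (Tr.one _ _ _ (back_move S k (bE_up (m + n) (by omega)) _ (by omega)))
  have e : (⟨m + n + 1, by omega⟩ : Fin (m+n+2)) = attach (Fin.last (n+1)) := Fin.ext attach_last.symm
  rw [e] at h4
  have h5 := h4.comp (Tr.one _ _ _ (fin_move S k (Fin.last (n+1)) (by simp) _ (by omega) (by omega)).1)
  refine ⟨_, _, h5.mono ?_⟩
  rintro (y | j | p) -
  · by_cases hy : y.val ≤ m + n
    · exact Or.inl (Or.inl (Or.inr (Or.inl ⟨y, hy, rfl⟩)))
    · refine Or.inr (Or.inl ?_)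
      rw [← e]
      have : y = ⟨m + n + 1, by omega⟩ := Fin.ext (by simp only []; omega)
      rw [this]; rfl
  · obtain ⟨i, hi, hj⟩ := hcov j
    exact Or.inl (Or.inl (Or.inl (Or.inl (Or.inl ⟨i, i.isLt, Or.inl ⟨hi, j, hj, rfl⟩⟩))))
  · by_cases hp0 : p = 0
    · subst hp0
      exact Or.inl (Or.inl (Or.inl (Or.inr (Or.inl (Or.inr rfl)))))
    · by_cases hpl : p = Fin.last (n+1)
      · subst hpl
        exact Or.inr (Or.inr rfl)
      · have a1 : p.val ≠ 0 := fun h => hp0 (Fin.ext h)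
        have a2 : p.val ≠ n + 1 := fun h => hpl (Fin.ext h)
        have a3 := p.isLt
        obtain ⟨i, rfl⟩ : ∃ i : Fin n, p = pIdx i :=
          ⟨⟨p.val - 1, by omega⟩, Fin.ext (by simp only [pIdx]; omega)⟩
        by_cases hi : i ∈ I
        · exact Or.inl (Or.inl (Or.inr (Or.inr ⟨i, hi, i.isLt, rfl⟩)))
        · exact Or.inl (Or.inl (Or.inl (Or.inl (Or.inl ⟨i, i.isLt, Or.inr ⟨hi, rfl⟩⟩))))

end Aux

open Stmt4 in
/-- The comb TVG built from a set-cover instance admits a journey from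
`b_0` at time `0` covering all vertices by time `D` (the total duration) iff the family
contains a cover of `{1,…,m}` of size at most `k`. -/
theorem comb_setCover_reduction (m n k : ℕ) (hk : 0 < k) (S : Fin n → Finset (Fin m)) :
    (∃ J, (𝒢 S k).IsCoveringFrom J (bb ⟨0, by omega⟩) ∧ arrival J 0 ≤ D S k) ↔
      ∃ I : Finset (Fin n), I.card ≤ k ∧ ∀ j : Fin m, ∃ i ∈ I, j ∈ S i := by
  constructor
  · rintro ⟨J, ⟨⟨h1, h2⟩, h3, h4⟩, -⟩
    obtain ⟨pos, p1, p2, p3⟩ := Aux.traj_of_journey (𝒢 S k).avail J _ 0 (fun x hx => (h1 x hx).2) h2 h3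
      (fun _ _ => Nat.zero_le _)
    refine Aux.forward S k pos (fun t => p2 t (Nat.zero_le _)) p1 ?_
    intro v
    rcases h4 v with rfl | ⟨x, hx, rfl⟩
    · exact ⟨0, Nat.zero_le _, p1⟩
    · exact ⟨x.2.2 + 1, Aux.avail_lt (h1 x hx).2, (p3 x hx).2⟩
  · rintro ⟨I, hI, hcov⟩
    obtain ⟨t, v, h⟩ := Aux.backward S k I hI hcov
    obtain ⟨J, h1, h2, h3, h4, h5⟩ := h.journey
    refine ⟨J, ⟨⟨h1, h2⟩, h3, fun v => h5 v (Set.mem_univ _)⟩, ?_⟩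
    unfold arrival
    cases hl : J.getLast? with
    | none => simp
    | some x => exact Aux.avail_lt (h1 x (List.mem_of_getLast? hl)).2
end

section
/- Let s_1,…,s_{3m} be positive integers with M = Σ_{i=1}^{3m} s_i, suppose B = M/m is an integer, let Δ ≥ 2 be an integer, and let k > 2M + 2m. Construct the spider G with center c, one arm of length s_i for each i, m checkpoint arms of length one, and one long arm A_0 of length k. For a time interval, an arm is steady if all its edges are available at every time of the interval; flashing if every edge e of the arm satisfies ρ(e,t) = 1 iff t − τ ≡ Δ − 1 (mod Δ), where τ is the start of the interval; and carrying if its edges behave as when flashing except that, labeling the arm c a_1 … a_l outward from c, the edge into a_i is additionally available at time τ + i − 1, so that an agent leaving c at time τ can traverse the arm to its leaf without waiting. Let take be the temporal subgraph of duration 2B in which the s_i-arms are steady and all other arms are flashing; let check be the temporal subgraph of duration 2 in which the checkpoint arms are steady and all other arms are flashing; let finish be the temporal subgraph of duration k in which A_0 is carrying and all other arms are flashing. Let 𝒢 be the TVG formed by alternating take and check m times, followed by finish, of total duration D = 2M + 2m + k. Then there exists a journey starting at c at time 0 that visits every vertex of G and arrives by time D if and only if {s_1,…,s_{3m}} can be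 partitioned into m multisets each with sum B. -/
open TVG

namespace Stmt5

/-- Vertices of the spider: the center, the arm of length `s i` for each of the `3m`
integers, `m` checkpoint arms of length one, and the long arm `A_0` of length `k`. -/
abbrev SpV (m k : ℕ) (s : Fin (3 * m) → ℕ) :=
  Unit ⊕ (Σ i : Fin (3 * m), Fin (s i)) ⊕ Fin m ⊕ Fin k

variable {m k : ℕ} {s : Fin (3 * m) → ℕ}

def ctr : SpV m k s := Sum.inl ()
def armv (i : Fin (3 * m)) (p : Fin (s i)) : SpV m k s := Sum.inr (Sum.inl ⟨i, p⟩)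
def chk (j : Fin m) : SpV m k s := Sum.inr (Sum.inr (Sum.inl j))
def lng (p : Fin k) : SpV m k s := Sum.inr (Sum.inr (Sum.inr p))

/-- Edges of the arm corresponding to the integer `s i`. -/
def sArmE (u v : SpV m k s) : Prop :=
  (∃ (i : Fin (3 * m)) (p : Fin (s i)), p.val = 0 ∧ u = ctr ∧ v = armv i p) ∨
  (∃ (i : Fin (3 * m)) (p q : Fin (s i)), q.val = p.val + 1 ∧ u = armv i p ∧ v = armv i q)

/-- Edges of the checkpoint arms. -/
def chkE (u v : SpV m k s) : Prop := ∃ j : Fin m, u = ctr ∧ v = chk j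

/-- Edges of the long arm `A_0`, together with their depth `d` (the edge into the
`(d+1)`-st vertex of the arm has depth `d`). -/
def lngE (d : ℕ) (u v : SpV m k s) : Prop :=
  (∃ p : Fin k, p.val = 0 ∧ d = 0 ∧ u = ctr ∧ v = lng p) ∨
  (∃ p q : Fin k, q.val = p.val + 1 ∧ d = q.val ∧ u = lng p ∧ v = lng q)

/-- The underlying spider. -/
def spiderG (m k : ℕ) (s : Fin (3 * m) → ℕ) : SimpleGraph (SpV m k s) :=
  SimpleGraph.fromRel (fun u v => sArmE u v ∨ chkE u v ∨ ∃ d, lngE d u v)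

def symP (r : SpV m k s → SpV m k s → Prop) (u v : SpV m k s) : Prop := r u v ∨ r v u

/-- Flashing availability: available exactly when the local time is `≡ Δ - 1 (mod Δ)`. -/
def flash (Δ t : ℕ) : Prop := t % Δ = Δ - 1

/-- `take`: the `s_i`-arms are steady, all other arms are flashing. -/
def takeR (Δ : ℕ) (u v : SpV m k s) (t : ℕ) : Prop :=
  symP sArmE u v ∨ ((symP chkE u v ∨ symP (fun a b => ∃ d, lngE d a b) u v) ∧ flash Δ t)

/-- `check`: the checkpoint arms are steady, all other arms are flashing. -/
def checkR (Δ : ℕ) (u v : SpV m k s) (t : ℕ) : Prop :=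
  symP chkE u v ∨ ((symP sArmE u v ∨ symP (fun a b => ∃ d, lngE d a b) u v) ∧ flash Δ t)

/-- `finish`: the long arm is carrying (its depth-`d` edge is additionally available at
local time `d`), all other arms are flashing. -/
def finishR (Δ : ℕ) (u v : SpV m k s) (t : ℕ) : Prop :=
  ((symP sArmE u v ∨ symP chkE u v) ∧ flash Δ t) ∨
  (∃ d, symP (lngE d) u v ∧ (flash Δ t ∨ t = d))

/-- The schedule: alternate `take` (duration `2B`) and `check` (duration `2`) `m` times,
then `finish` (duration `k`). -/
def blocks (Δ B : ℕ) : List ((SpV m k s → SpV m k s → ℕ → Prop) × ℕ) :=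
  ((List.range m).flatMap fun _ => [(takeR Δ, 2 * B), (checkR Δ, 2)]) ++ [(finishR Δ, k)]

/-- The TVG of the reduction. -/
def 𝒢 (m k : ℕ) (s : Fin (3 * m) → ℕ) (Δ B : ℕ) : TVG (SpV m k s) :=
  ⟨spiderG m k s, schedAvail (blocks Δ B)⟩

end Stmt5


namespace Stmt5
section helpers
variable {m k : ℕ} {s : Fin (3 * m) → ℕ}

/-! ### The schedule -/

theorem sched_take {V : Type} (r1 r2 : V → V → ℕ → Prop) (d1 d2 : ℕ)
    (L : List ((V → V → ℕ → Prop) × ℕ)) (u v : V) (l : List ℕ) :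
    ∀ j r, j < l.length → r < d1 →
      (schedAvail ((l.flatMap fun _ => [(r1, d1), (r2, d2)]) ++ L) u v (j * (d1 + d2) + r)
        ↔ r1 u v r) := by
  induction l with
  | nil => intro j r h; simp at h
  | cons a l ih =>
    intro j r h hr
    rw [List.flatMap_cons]
    simp only [List.cons_append, List.nil_append, schedAvail]
    cases j with
    | zero => simp [hr]
    | succ j =>
      have h1 : ¬ ((j + 1) * (d1 + d2) + r < d1) := by
        rw [Nat.add_mul]; omega
      have h2 : ¬ ((j + 1) * (d1 + d2) + r - d1 < d2) := by
        rw [Nat.add_mul]; omega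
      have h3 : (j + 1) * (d1 + d2) + r - d1 - d2 = j * (d1 + d2) + r := by
        rw [Nat.add_mul]; omega
      rw [if_neg h1, if_neg h2, h3]
      exact ih j r (by simpa using h) hr

theorem sched_check {V : Type} (r1 r2 : V → V → ℕ → Prop) (d1 d2 : ℕ)
    (L : List ((V → V → ℕ → Prop) × ℕ)) (u v : V) (l : List ℕ) :
    ∀ j r, j < l.length → r < d2 →
      (schedAvail ((l.flatMap fun _ => [(r1, d1), (r2, d2)]) ++ L) u v
        (j * (d1 + d2) + d1 + r) ↔ r2 u v r) := by
  induction l with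
  | nil => intro j r h; simp at h
  | cons a l ih =>
    intro j r h hr
    rw [List.flatMap_cons]
    simp only [List.cons_append, List.nil_append, schedAvail]
    cases j with
    | zero => simp [hr]
    | succ j =>
      have h1 : ¬ ((j + 1) * (d1 + d2) + d1 + r < d1) := by omega
      have h2 : ¬ ((j + 1) * (d1 + d2) + d1 + r - d1 < d2) := by
        rw [Nat.add_mul]; omega
      have h3 : (j + 1) * (d1 + d2) + d1 + r - d1 - d2 = j * (d1 + d2) + d1 + r := by
        rw [Nat.add_mul]; omega
      rw [if_neg h1, if_neg h2, h3]
      exact ih j r (by simpa using h) hr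

theorem sched_rest {V : Type} (r1 r2 : V → V → ℕ → Prop) (d1 d2 : ℕ)
    (L : List ((V → V → ℕ → Prop) × ℕ)) (u v : V) (l : List ℕ) (r : ℕ) :
      (schedAvail ((l.flatMap fun _ => [(r1, d1), (r2, d2)]) ++ L) u v
        (l.length * (d1 + d2) + r) ↔ schedAvail L u v r) := by
  induction l with
  | nil => simp
  | cons a l ih =>
    rw [List.flatMap_cons]
    simp only [List.cons_append, List.nil_append, schedAvail, List.length_cons]
    have h1 : ¬ ((l.length + 1) * (d1 + d2) + r < d1) := by
      rw [Nat.add_mul]; omega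
    have h2 : ¬ ((l.length + 1) * (d1 + d2) + r - d1 < d2) := by
      rw [Nat.add_mul]; omega
    have h3 : (l.length + 1) * (d1 + d2) + r - d1 - d2 = l.length * (d1 + d2) + r := by
      rw [Nat.add_mul]; omega
    rw [if_neg h1, if_neg h2, h3]
    exact ih

theorem avail_take (Δ B : ℕ) (u v : SpV m k s) (j r : ℕ) (hj : j < m) (hr : r < 2 * B) :
    (𝒢 m k s Δ B).avail u v (j * (2 * B + 2) + r) ↔ takeR Δ u v r :=
  sched_take _ _ _ _ _ u v (List.range m) j r (by simpa using hj) hr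

theorem avail_check (Δ B : ℕ) (u v : SpV m k s) (j r : ℕ) (hj : j < m) (hr : r < 2) :
    (𝒢 m k s Δ B).avail u v (j * (2 * B + 2) + 2 * B + r) ↔ checkR Δ u v r :=
  sched_check _ _ _ _ _ u v (List.range m) j r (by simpa using hj) hr

theorem avail_finish (Δ B : ℕ) (u v : SpV m k s) (r : ℕ) (hr : r < k) :
    (𝒢 m k s Δ B).avail u v (m * (2 * B + 2) + r) ↔ finishR Δ u v r := by
  have := sched_rest (takeR (m := m) (k := k) (s := s) Δ) (checkR Δ) (2 * B) 2
    [(finishR Δ, k)] u v (List.range m) r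
  rw [List.length_range] at this
  refine this.trans ?_
  simp [schedAvail, hr]

/-! ### The spider -/

def depth : SpV m k s → ℕ
  | Sum.inl _ => 0
  | Sum.inr (Sum.inl ⟨_, p⟩) => p.val + 1
  | Sum.inr (Sum.inr (Sum.inl _)) => 1
  | Sum.inr (Sum.inr (Sum.inr p)) => p.val + 1

def par : SpV m k s → SpV m k s
  | Sum.inl _ => ctr
  | Sum.inr (Sum.inl ⟨i, p⟩) => if p.val = 0 then ctr else armv i ⟨p.val - 1, by omega⟩
  | Sum.inr (Sum.inr (Sum.inl _)) => ctr
  | Sum.inr (Sum.inr (Sum.inr p)) => if p.val = 0 then ctr else lng ⟨p.val - 1, by omega⟩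

/-- `w` is in the subtree of `v`. -/
def sub : SpV m k s → SpV m k s → Prop
  | Sum.inl _, _ => True
  | Sum.inr (Sum.inl ⟨i, p⟩), w => ∃ q : Fin (s i), p ≤ q ∧ w = armv i q
  | Sum.inr (Sum.inr (Sum.inl j)), w => w = chk j
  | Sum.inr (Sum.inr (Sum.inr p)), w => ∃ q : Fin k, p ≤ q ∧ w = lng q

def Down (u v : SpV m k s) : Prop := sArmE u v ∨ chkE u v ∨ ∃ d, lngE d u v

theorem depth_par (x : (Σ i : Fin (3 * m), Fin (s i)) ⊕ Fin m ⊕ Fin k) :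
    depth (par (Sum.inr x : SpV m k s)) + 1 = depth (Sum.inr x : SpV m k s) := by
  rcases x with ⟨i, p⟩ | j | p
  · simp only [par, depth]
    split_ifs with h
    · simp [ctr, h]
    · simp only [armv]; omega
  · simp [par, depth, ctr]
  · simp only [par, depth]
    split_ifs with h
    · simp [ctr, h]
    · simp only [lng]; omega

theorem Down.par_eq {u v : SpV m k s} (h : Down u v) : u = par v ∧ v ≠ ctr := by
  rcases h with (⟨i, p, hp, rfl, rfl⟩ | ⟨i, p, q, hq, rfl, rfl⟩) | ⟨j, rfl, rfl⟩ |
    ⟨d, ⟨p, hp, -, rfl, rfl⟩ | ⟨p, q, hq, -, rfl, rfl⟩⟩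
  · simp [par, armv, hp, ctr]
  · simp [par, armv, hq, ctr]
  · simp [par, chk, ctr]
  · simp [par, lng, hp, ctr]
  · simp [par, lng, hq, ctr]

theorem Down.ne {u v : SpV m k s} (h : Down u v) : u ≠ v := by
  obtain ⟨h1, h2⟩ := h.par_eq
  intro h3
  rcases v with v | x
  · exact h2 rfl
  · have := depth_par x
    rw [← h1, h3] at this
    omega

theorem adj_iff {u v : SpV m k s} : (spiderG m k s).Adj u v ↔ Down u v ∨ Down v u := by
  simp only [spiderG, SimpleGraph.fromRel_adj]
  constructor
  · exact fun h => h.2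
  · intro h
    refine ⟨?_, h⟩
    rcases h with h | h
    · exact h.ne
    · exact h.ne.symm

theorem adj_depth {u v : SpV m k s} (h : (spiderG m k s).Adj u v) :
    depth u % 2 ≠ depth v % 2 := by
  have key : ∀ u v : SpV m k s, Down u v → depth u + 1 = depth v := by
    intro u v h
    obtain ⟨h1, h2⟩ := h.par_eq
    rcases v with v | x
    · exact absurd rfl h2
    · rw [h1]; exact depth_par x
  rcases adj_iff.1 h with h | h
  · have := key _ _ h; omega
  · have := key _ _ h; omega

theorem sub_self (v : SpV m k s) : sub v v := by
  rcases v with v | ⟨i, p⟩ | j | p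
  · trivial
  · exact ⟨p, le_rfl, rfl⟩
  · exact rfl
  · exact ⟨p, le_rfl, rfl⟩

theorem not_sub_ctr (x : (Σ i : Fin (3 * m), Fin (s i)) ⊕ Fin m ⊕ Fin k) :
    ¬ sub (Sum.inr x : SpV m k s) ctr := by
  rcases x with ⟨i, p⟩ | j | p
  · rintro ⟨q, -, h⟩; simp [ctr, armv] at h
  · intro h; simp [sub, ctr, chk] at h
  · rintro ⟨q, -, h⟩; simp [ctr, lng] at h

/-- a child whose parent is outside the subtree of `v`, or conversely -/
theorem down_cross {u w v : SpV m k s} (h : Down u w) :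
    (¬ sub v u → sub v w → w = v) ∧ (sub v u → sub v w) := by
  rcases v with v | ⟨i, p⟩ | j | p
  · exact ⟨fun h => absurd trivial h, fun _ => trivial⟩
  · rcases h with (⟨i', p', hp, rfl, rfl⟩ | ⟨i', p', q', hq, rfl, rfl⟩) | ⟨j, rfl, rfl⟩ |
      ⟨d, ⟨p', hp, -, rfl, rfl⟩ | ⟨p', q', hq, -, rfl, rfl⟩⟩
    · simp only [sub, armv, ctr]
      constructor
      · rintro - ⟨q, hpq, h⟩
        simp only [Sum.inr.injEq, Sum.inl.injEq, Sigma.mk.injEq] at h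
        obtain ⟨rfl, h⟩ := h
        have h := eq_of_heq h
        subst h
        have : p = p' := by ext; have := Fin.le_def.1 hpq; omega
        rw [this]
      · rintro ⟨q, -, h⟩; simp at h
    · simp only [sub, armv]
      constructor
      · rintro h1 ⟨q, hpq, h⟩
        simp only [Sum.inr.injEq, Sum.inl.injEq, Sigma.mk.injEq] at h
        obtain ⟨rfl, h⟩ := h
        have h := eq_of_heq h
        subst h
        have h2 : ¬ p ≤ p' := fun h2 => h1 ⟨p', h2, rfl⟩
        have : p = q' := by
          ext; have := Fin.le_def.1 hpq; rw [Fin.le_def] at h2; omega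
        rw [this]
      · rintro ⟨q, hpq, h⟩
        simp only [Sum.inr.injEq, Sum.inl.injEq, Sigma.mk.injEq] at h
        obtain ⟨rfl, h⟩ := h
        have h := eq_of_heq h
        subst h
        exact ⟨q', by rw [Fin.le_def] at *; omega, rfl⟩
    · simp [sub, armv, ctr, chk]
    · simp [sub, armv, ctr, lng]
    · simp [sub, armv, lng]
  · rcases h with (⟨i', p', hp, rfl, rfl⟩ | ⟨i', p', q', hq, rfl, rfl⟩) | ⟨j, rfl, rfl⟩ |
      ⟨d, ⟨p', hp, -, rfl, rfl⟩ | ⟨p', q', hq, -, rfl, rfl⟩⟩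
    · simp [sub, armv, ctr, chk]
    · simp [sub, armv, chk]
    · simp only [sub, ctr, chk]
      exact ⟨fun _ h => h, fun h => by simp at h⟩
    · simp [sub, ctr, chk, lng]
    · simp [sub, chk, lng]
  · rcases h with (⟨i', p', hp, rfl, rfl⟩ | ⟨i', p', q', hq, rfl, rfl⟩) | ⟨j, rfl, rfl⟩ |
      ⟨d, ⟨p', hp, -, rfl, rfl⟩ | ⟨p', q', hq, -, rfl, rfl⟩⟩
    · simp [sub, armv, ctr, lng]
    · simp [sub, armv, lng]
    · simp [sub, ctr, chk, lng]
    · simp only [sub, ctr, lng]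
      constructor
      · rintro - ⟨q, hpq, h⟩
        simp only [Sum.inr.injEq] at h
        subst h
        have : p = p' := by ext; have := Fin.le_def.1 hpq; omega
        rw [this]
      · rintro ⟨q, -, h⟩; simp at h
    · simp only [sub, lng]
      constructor
      · rintro h1 ⟨q, hpq, h⟩
        simp only [Sum.inr.injEq] at h
        subst h
        have h2 : ¬ p ≤ p' := fun h2 => h1 ⟨p', h2, rfl⟩
        have : p = q' := by
          ext; have := Fin.le_def.1 hpq; rw [Fin.le_def] at h2; omega
        rw [this]
      · rintro ⟨q, hpq, h⟩
        simp only [Sum.inr.injEq] at h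
        subst h
        exact ⟨q', by rw [Fin.le_def] at *; omega, rfl⟩

theorem cross {u w v : SpV m k s} (h : (spiderG m k s).Adj u w)
    (h1 : ¬ sub v u) (h2 : sub v w) : u = par v ∧ w = v := by
  rcases adj_iff.1 h with h | h
  · have := (down_cross h).1 h1 h2
    subst this
    exact ⟨h.par_eq.1, rfl⟩
  · exact absurd ((down_cross h).2 h2) h1

theorem cross_in {V : Type} (q : ℕ → V) (S : V → Prop) (i : ℕ) :
    ∀ j, i ≤ j → ¬ S (q i) → S (q j) → ∃ l, i ≤ l ∧ l < j ∧ ¬ S (q l) ∧ S (q (l + 1)) := by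
  intro j hij hi
  induction j, hij using Nat.le_induction with
  | base => intro h; exact absurd h hi
  | succ j hij ih =>
    intro h
    by_cases hj : S (q j)
    · obtain ⟨l, h1, h2, h3⟩ := ih hj
      exact ⟨l, h1, by omega, h3⟩
    · exact ⟨j, hij, by omega, hj, h⟩

/-! ### From a list journey to functions -/

theorem journey_fun {V : Type} (𝒢 : TVG V) (J : List (Step V)) (c : V) (D : ℕ)
    (h : 𝒢.IsCoveringFrom J c) (ha : arrival J 0 ≤ D) :
    ∃ (n : ℕ) (q : ℕ → V) (τ : ℕ → ℕ), q 0 = c ∧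
      (∀ i < n, 𝒢.G.Adj (q i) (q (i + 1)) ∧ 𝒢.avail (q i) (q (i + 1)) (τ i)) ∧
      (∀ i, i + 1 < n → τ i < τ (i + 1)) ∧ (0 < n → τ (n - 1) < D) ∧
      (∀ v, ∃ i ≤ n, q i = v) := by
  obtain ⟨⟨h1, h2⟩, h3, h4⟩ := h
  have h2 := List.isChain_iff_getElem.1 h2
  set q : ℕ → V := fun i => if i = 0 then c else (J[i - 1]?).elim c (fun x => x.2.1) with hq
  set τ : ℕ → ℕ := fun i => (J[i]?).elim 0 (fun x => x.2.2) with hτ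
  have hq1 : ∀ i (hi : i < J.length), q (i + 1) = J[i].2.1 := by
    intro i hi
    simp [hq, hi]
  have hq2 : ∀ i (hi : i < J.length), q i = J[i].1 := by
    intro i hi
    cases i with
    | zero =>
      have := h3 J[0] (by simp [List.head?_eq_getElem?, hi])
      simp [hq, this]
    | succ i =>
      rw [hq1 i (by omega)]
      exact (h2 i hi).1.symm
  have hτ1 : ∀ i (hi : i < J.length), τ i = J[i].2.2 := by
    intro i hi
    simp [hτ, hi]
  refine ⟨J.length, q, τ, by simp [hq], ?_, ?_, ?_, ?_⟩
  · intro i hi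
    rw [hq1 i hi, hq2 i hi, hτ1 i hi]
    exact h1 _ (List.getElem_mem hi)
  · intro i hi
    rw [hτ1 i (by omega), hτ1 (i + 1) hi]
    have := (h2 i hi).2
    omega
  · intro hn
    rw [hτ1 _ (by omega)]
    have : J.getLast? = some J[J.length - 1] := by
      rw [List.getLast?_eq_getElem?]; simp [hn]
    simp only [arrival, this, Option.elim] at ha
    omega
  · intro v
    rcases h4 v with rfl | ⟨x, hx, rfl⟩
    · exact ⟨0, by omega, by simp [hq]⟩
    · obtain ⟨i, hi, rfl⟩ := List.getElem_of_mem hx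
      exact ⟨i + 1, hi, hq1 i hi⟩

end helpers
end Stmt5

namespace Stmt5
section backward
variable {m k : ℕ} {s : Fin (3 * m) → ℕ}

abbrev NC (m k : ℕ) (s : Fin (3 * m) → ℕ) := (Σ i : Fin (3 * m), Fin (s i)) ⊕ Fin m ⊕ Fin k

def embN : (Σ i : Fin (3 * m), Fin (s i)) ⊕ Fin m → NC m k s
  | Sum.inl x => Sum.inl x
  | Sum.inr j => Sum.inr (Sum.inl j)

def gE : NC m k s ⊕ ((Σ i : Fin (3 * m), Fin (s i)) ⊕ Fin m) → SpV m k s × SpV m k s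
  | Sum.inl x => (par (Sum.inr x), Sum.inr x)
  | Sum.inr y => (Sum.inr (embN y), par (Sum.inr (embN y)))

def gL : Fin k ⊕ Fin k → SpV m k s × SpV m k s
  | Sum.inl p => (par (lng p), lng p)
  | Sum.inr p => (lng p, par (lng p))

theorem embN_inj : Function.Injective (embN (m := m) (k := k) (s := s)) := by
  rintro (x | x) (y | y) h <;> simpa [embN] using h

theorem gE_inj : Function.Injective (gE (m := m) (k := k) (s := s)) := by
  rintro (x | x) (y | y) h
  · simp only [gE, Prod.mk.injEq, Sum.inr.injEq] at h
    rw [h.2]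
  · simp only [gE, Prod.mk.injEq] at h
    have h1 := depth_par x
    have h2 := depth_par (embN (k := k) y)
    rw [h.1] at h1
    rw [← h.2] at h2
    omega
  · simp only [gE, Prod.mk.injEq] at h
    have h1 := depth_par y
    have h2 := depth_par (embN (k := k) x)
    rw [← h.1] at h1
    rw [h.2] at h2
    omega
  · simp only [gE, Prod.mk.injEq, Sum.inr.injEq] at h
    rw [embN_inj h.1]

theorem lng_inj {p p' : Fin k} (h : (lng p : SpV m k s) = lng p') : p = p' := by
  simpa [lng] using h

theorem depth_par_lng (p : Fin k) :
    depth (par (lng p : SpV m k s)) + 1 = depth (lng p : SpV m k s) :=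
  depth_par (Sum.inr (Sum.inr p))

theorem gL_inj : Function.Injective (gL (m := m) (k := k) (s := s)) := by
  rintro (x | x) (y | y) h
  · simp only [gL, Prod.mk.injEq] at h
    rw [lng_inj h.2]
  · simp only [gL, Prod.mk.injEq] at h
    have h1 := depth_par_lng (m := m) (s := s) x
    have h2 := depth_par_lng (m := m) (s := s) y
    rw [h.1] at h1
    rw [← h.2] at h2
    omega
  · simp only [gL, Prod.mk.injEq] at h
    have h1 := depth_par_lng (m := m) (s := s) x
    have h2 := depth_par_lng (m := m) (s := s) y
    rw [← h.1] at h2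
    rw [h.2] at h1
    omega
  · simp only [gL, Prod.mk.injEq] at h
    rw [lng_inj h.1]

/-- The structure of a covering walk of the right duration: no waiting, no repeated directed
edge, and the long arm is never left. -/
theorem tight (hk : 2 * (∑ i, s i) + 2 * m < k) (n : ℕ) (q : ℕ → SpV m k s)
    (hn : n ≤ 2 * (∑ i, s i) + 2 * m + k)
    (h0 : q 0 = ctr) (hadj : ∀ i < n, (spiderG m k s).Adj (q i) (q (i + 1)))
    (hcov : ∀ v, ∃ i ≤ n, q i = v) :
    n = 2 * (∑ i, s i) + 2 * m + k ∧
    (∀ i < n, ∀ j < n, q i = q j → q (i + 1) = q (j + 1) → i = j) ∧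
    (∀ i < n, ∀ p : Fin k, ¬ (q i = lng p ∧ q (i + 1) = par (lng p))) ∧
    (∀ x : (Σ i : Fin (3 * m), Fin (s i)) ⊕ Fin m,
      ∃ i < n, q i = par (Sum.inr (embN x)) ∧ q (i + 1) = Sum.inr (embN x)) ∧
    (∀ x : (Σ i : Fin (3 * m), Fin (s i)) ⊕ Fin m,
      ∃ i < n, q i = Sum.inr (embN x) ∧ q (i + 1) = par (Sum.inr (embN x))) := by
  classical
  have hdown : ∀ x : NC m k s, ∃ i < n, q i = par (Sum.inr x) ∧ q (i + 1) = Sum.inr x := by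
    intro x
    obtain ⟨j, hj, hjx⟩ := hcov (Sum.inr x)
    obtain ⟨l, -, hl, h1, h2⟩ := cross_in q (sub (Sum.inr x)) 0 j (Nat.zero_le _)
      (by rw [h0]; exact not_sub_ctr x) (by rw [hjx]; exact sub_self _)
    exact ⟨l, by omega, cross (hadj l (by omega)) h1 h2⟩
  have hup : ∀ x : NC m k s, ¬ sub (Sum.inr x) (q n) →
      ∃ i < n, q i = Sum.inr x ∧ q (i + 1) = par (Sum.inr x) := by
    intro x hx
    obtain ⟨j, hj, hjx⟩ := hcov (Sum.inr x)
    obtain ⟨l, -, hl, h1, h2⟩ := cross_in q (fun w => ¬ sub (Sum.inr x) w) j n hj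
      (by rw [hjx]; exact not_not.2 (sub_self _)) hx
    have := cross (hadj l (by omega)).symm h2 (not_not.1 h1)
    exact ⟨l, by omega, this.2, this.1⟩
  set P : Finset (SpV m k s × SpV m k s) :=
    (Finset.range n).image (fun i => (q i, q (i + 1))) with hP
  have hPc : P.card ≤ n := by
    have := Finset.card_image_le (s := Finset.range n) (f := fun i => (q i, q (i + 1)))
    rwa [Finset.card_range] at this
  have hmem : ∀ a b, (∃ i < n, q i = a ∧ q (i + 1) = b) → (a, b) ∈ P := by
    rintro a b ⟨i, hi, rfl, rfl⟩
    exact Finset.mem_image.2 ⟨i, Finset.mem_range.2 hi, rfl⟩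
  by_cases hlong : ∃ p : Fin k, q n = lng p
  · obtain ⟨p, hp⟩ := hlong
    have hup' : ∀ x : (Σ i : Fin (3 * m), Fin (s i)) ⊕ Fin m,
        ∃ i < n, q i = Sum.inr (embN x) ∧ q (i + 1) = par (Sum.inr (embN x)) := by
      intro x
      apply hup
      rw [hp]
      rcases x with ⟨i, x⟩ | x
      · simp [sub, embN, lng, armv]
      · simp [sub, embN, lng, chk]
    have hsub : Finset.univ.image (gE (m := m) (k := k) (s := s)) ⊆ P := by
      intro e he
      obtain ⟨x | x, -, rfl⟩ := Finset.mem_image.1 he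
      · exact hmem _ _ (hdown x)
      · exact hmem _ _ (hup' x)
    have hc : (Finset.univ.image (gE (m := m) (k := k) (s := s))).card
        = 2 * (∑ i, s i) + 2 * m + k := by
      rw [Finset.card_image_of_injective _ gE_inj, Finset.card_univ]
      simp only [Fintype.card_sum, Fintype.card_sigma, Fintype.card_fin]
      ring
    have hle := Finset.card_le_card hsub
    have hnD : n = 2 * (∑ i, s i) + 2 * m + k := by omega
    have hPeq := Finset.eq_of_subset_of_card_le hsub (by omega)
    have hinj : Set.InjOn (fun i => (q i, q (i + 1))) (Finset.range n : Set ℕ) := by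
      apply Finset.card_image_iff.1
      rw [Finset.card_range]
      have hnP : n ≤ P.card := by omega
      exact le_antisymm hPc hnP
    refine ⟨hnD, ?_, ?_, fun x => hdown _, hup'⟩
    · intro i hi j hj h1 h2
      exact hinj (by simpa using hi) (by simpa using hj) (by simp [h1, h2])
    · intro i hi p hip
      have := hmem _ _ ⟨i, hi, hip⟩
      rw [← hPeq] at this
      obtain ⟨x | x, -, hx⟩ := Finset.mem_image.1 this
      · simp only [gE, Prod.mk.injEq] at hx
        have h1 := depth_par x
        have h2 := depth_par_lng (m := m) (s := s) p
        rw [hx.1] at h1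
        rw [← hx.2] at h2
        omega
      · simp only [gE, Prod.mk.injEq] at hx
        have hx := hx.1
        rcases x with x | x <;> simp [embN, lng] at hx
  · exfalso
    have hsub : Finset.univ.image (gL (m := m) (k := k) (s := s)) ⊆ P := by
      intro e he
      obtain ⟨p | p, -, rfl⟩ := Finset.mem_image.1 he
      · exact hmem _ _ (hdown (Sum.inr (Sum.inr p)))
      · refine hmem _ _ (hup (Sum.inr (Sum.inr p)) ?_)
        rintro ⟨p', -, h⟩
        exact hlong ⟨p', h⟩
    have hc : (Finset.univ.image (gL (m := m) (k := k) (s := s))).card = 2 * k := by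
      rw [Finset.card_image_of_injective _ gL_inj, Finset.card_univ]
      simp only [Fintype.card_sum, Fintype.card_fin]
      ring
    have hle := Finset.card_le_card hsub
    omega

theorem not_flash_zero {Δ : ℕ} (hΔ : 2 ≤ Δ) : ¬ flash Δ 0 := by
  simp only [flash, Nat.zero_mod]; omega

theorem backward (m B Δ k : ℕ) (hΔ : 2 ≤ Δ)
    (s : Fin (3 * m) → ℕ) (hs : ∀ i, 0 < s i) (hM : ∑ i, s i = m * B)
    (hk : 2 * (∑ i, s i) + 2 * m < k)
    (h : ∃ J, (𝒢 m k s Δ B).IsCoveringFrom J ctr ∧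
        arrival J 0 ≤ 2 * (∑ i, s i) + 2 * m + k) :
      ∃ f : Fin (3 * m) → Fin m, ∀ j : Fin m,
        ∑ i ∈ Finset.univ.filter (fun i => f i = j), s i = B := by
  classical
  obtain ⟨J, hJ, harr⟩ := h
  obtain ⟨n, q, τ, h0, hstep, hτ, hτl, hcov⟩ := journey_fun _ J ctr _ hJ harr
  have hτ2 : ∀ i d, i + d < n → τ i + d ≤ τ (i + d) := by
    intro i d
    induction d with
    | zero => simp
    | succ d ih =>
      intro hd
      have := ih (by omega)
      have := hτ (i + d) (by omega)
      change τ i + (d + 1) ≤ τ (i + d + 1)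
      omega
  have hn : n ≤ 2 * (∑ i, s i) + 2 * m + k := by
    by_contra hc
    have h1 := hτ2 0 (n - 1) (by omega)
    have h2 := hτl (by omega)
    rw [zero_add] at h1
    omega
  obtain ⟨hnD, hinj, hnolong, hdn, hup⟩ := tight hk n q hn h0 (fun i hi => (hstep i hi).1) hcov
  have hτi : ∀ i < n, τ i = i := by
    intro i hi
    have h1 := hτ2 0 i (by omega)
    have h2 := hτ2 i (n - 1 - i) (by omega)
    have h3 := hτl (by omega)
    rw [show i + (n - 1 - i) = n - 1 by omega] at h2
    rw [zero_add] at h1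
    omega
  have hav : ∀ i < n, (𝒢 m k s Δ B).avail (q i) (q (i + 1)) i := by
    intro i hi
    have := (hstep i hi).2
    rwa [hτi i hi] at this
  have hadj : ∀ i < n, (spiderG m k s).Adj (q i) (q (i + 1)) := fun i hi => (hstep i hi).1
  have hD : m * (2 * B + 2) = 2 * (∑ i, s i) + 2 * m := by rw [hM]; ring
  have hpar : ∀ i ≤ n, depth (q i) % 2 = i % 2 := by
    intro i
    induction i with
    | zero => intro _; rw [h0]; rfl
    | succ i ih =>
      intro hi
      have h1 := ih (by omega)
      have h2 := adj_depth (hadj i (by omega))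
      omega
  -- block arithmetic
  have hblk : ∀ j < m, j * (2 * B + 2) + (2 * B + 2) ≤ m * (2 * B + 2) := by
    intro j hj
    have := Nat.mul_le_mul_right (2 * B + 2) (Nat.succ_le_of_lt hj)
    rw [Nat.succ_mul] at this
    exact this
  -- check blocks
  have hchk : ∀ j < m, ∃ c : Fin m, q (j * (2 * B + 2) + 2 * B) = ctr ∧
      q (j * (2 * B + 2) + 2 * B + 1) = chk c ∧ q (j * (2 * B + 2) + 2 * B + 2) = ctr := by
    intro j hj
    have hb := hblk j hj
    have hlt : j * (2 * B + 2) + 2 * B + 1 < n := by omega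
    have h1 := (avail_check Δ B _ _ j 0 hj (by omega)).1 (hav (j * (2 * B + 2) + 2 * B) (by omega))
    have hp := hpar (j * (2 * B + 2) + 2 * B) (by omega)
    have he : (j * (2 * B + 2) + 2 * B) % 2 = 0 := by
      rw [show j * (2 * B + 2) + 2 * B = 2 * (j * (B + 1) + B) by ring]; simp
    rcases h1 with (⟨c, h1, h2⟩ | ⟨c, h1, h2⟩) | ⟨-, h1⟩
    · refine ⟨c, h1, h2, ?_⟩
      have h3 := hadj _ hlt
      rw [h2] at h3
      by_cases h4 : sub (chk c) (q (j * (2 * B + 2) + 2 * B + 1 + 1))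
      · have h4 : q (j * (2 * B + 2) + 2 * B + 1 + 1) = chk c := h4
        rw [h4] at h3
        exact absurd rfl h3.ne
      · exact (cross h3.symm h4 (sub_self _)).1
    · rw [h2, he] at hp
      simp [depth, chk] at hp
    · exact absurd h1 (not_flash_zero hΔ)
  have hstart : ∀ j < m, q (j * (2 * B + 2)) = ctr := by
    intro j hj
    cases j with
    | zero => simpa using h0
    | succ j =>
      obtain ⟨c, -, -, h⟩ := hchk j (by omega)
      rw [← h]; congr 1; ring
  -- finish
  have hfin0 : ∃ p : Fin k, p.val = 0 ∧ q (m * (2 * B + 2) + 1) = lng p := by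
    have h1 := (avail_finish Δ B _ _ 0 (by omega)).1 (hav (m * (2 * B + 2)) (by omega))
    rcases h1 with ⟨-, h1⟩ | ⟨d, h1, h2⟩
    · exact absurd h1 (not_flash_zero hΔ)
    · have hd : 0 = d := h2.resolve_left (not_flash_zero hΔ)
      subst hd
      rcases h1 with (⟨p, hp, -, -, h⟩ | ⟨p, p', hp, h, -⟩) |
        (⟨p, hp, -, h1, h2⟩ | ⟨p, p', hp, h, -⟩)
      · exact ⟨p, hp, h⟩
      · omega
      · exfalso
        refine hnolong (m * (2 * B + 2)) (by omega) p ⟨h2, ?_⟩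
        rw [h1]; simp [par, lng, hp]
      · omega
  have hfin : ∀ t, m * (2 * B + 2) + 1 ≤ t → t ≤ n → ∃ p : Fin k, q t = lng p := by
    obtain ⟨p0, hp0, hq⟩ := hfin0
    intro t ht htn
    by_contra hc
    obtain ⟨l, h1, h2, h3, h4⟩ := cross_in q (fun w => ¬ sub (lng p0) w) _ t ht
      (by rw [hq]; exact not_not.2 (sub_self _))
      (by rintro ⟨p, -, hp⟩; exact hc ⟨p, hp⟩)
    have := cross (hadj l (by omega)).symm h4 (not_not.1 h3)
    exact hnolong l (by omega) p0 ⟨this.2, this.1⟩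
  -- arm steps
  let fst : (i : Fin (3 * m)) → Fin (s i) := fun i => ⟨0, hs i⟩
  have harm : ∀ i : Fin (3 * m), ∀ t < n,
      (∃ p, q t = armv i p) ∨ (∃ p, q (t + 1) = armv i p) →
      ∃ j < m, ∃ t0, j * (2 * B + 2) ≤ t0 ∧ t0 < j * (2 * B + 2) + 2 * B ∧
        j * (2 * B + 2) ≤ t ∧ t < j * (2 * B + 2) + 2 * B ∧
        q t0 = ctr ∧ q (t0 + 1) = armv i (fst i) := by
    intro i t ht harm
    have ht1 : t < m * (2 * B + 2) := by
      by_contra hc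
      rcases harm with ⟨p, hp⟩ | ⟨p, hp⟩
      · by_cases h : t = m * (2 * B + 2)
        · subst h
          obtain ⟨p0, hp0, hq⟩ := hfin0
          have h1 := hadj _ ht
          have h2 := cross (v := lng p0) h1 (by rw [hp]; rintro ⟨_, -, h⟩; simp [armv, lng] at h)
            (by rw [hq]; exact sub_self _)
          rw [hp] at h2
          simp [par, lng, hp0, armv, ctr] at h2
        · obtain ⟨p', hp'⟩ := hfin t (by omega) (by omega)
          rw [hp] at hp'
          simp [armv, lng] at hp'
      · obtain ⟨p', hp'⟩ := hfin (t + 1) (by omega) (by omega)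
        rw [hp] at hp'
        simp [armv, lng] at hp'
    have hpos : 0 < 2 * B + 2 := by omega
    have hj : t / (2 * B + 2) < m := (Nat.div_lt_iff_lt_mul hpos).2 ht1
    have hr : t % (2 * B + 2) < 2 * B + 2 := Nat.mod_lt _ hpos
    have htd : t / (2 * B + 2) * (2 * B + 2) + t % (2 * B + 2) = t := Nat.div_add_mod' _ _
    generalize t / (2 * B + 2) = j at hj htd
    generalize t % (2 * B + 2) = r at hr htd
    have hr2 : r < 2 * B := by
      by_contra hc
      obtain ⟨c, h1, h2, h3⟩ := hchk j hj
      rcases (by omega : r = 2 * B ∨ r = 2 * B + 1) with hrr | hrr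
      · rw [hrr] at htd
        rw [htd] at h1 h2
        rw [h1, h2] at harm
        simp [armv, ctr, chk] at harm
      · rw [hrr, ← add_assoc] at htd
        rw [htd] at h2
        have h3' : q (t + 1) = ctr := by rw [← htd]; exact h3
        rw [h2, h3'] at harm
        simp [armv, ctr, chk] at harm
    have hend : ∃ t', t' ≤ t + 1 ∧ j * (2 * B + 2) ≤ t' ∧ ∃ p, q t' = armv i p := by
      rcases harm with h | h
      · exact ⟨t, by omega, by omega, h⟩
      · exact ⟨t + 1, by omega, by omega, h⟩
    obtain ⟨t', ht', hjt', p, hp⟩ := hend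
    obtain ⟨l, h1, h2, h3, h4⟩ := cross_in q (sub (armv i (fst i))) _ t' hjt'
      (by rw [hstart j hj]; exact not_sub_ctr _)
      (by rw [hp]; exact ⟨p, by simp [fst, Fin.le_def], rfl⟩)
    have hc := cross (hadj l (by omega)) h3 h4
    refine ⟨j, hj, l, h1, by omega, by omega, by omega, ?_, hc.2⟩
    rw [hc.1]; simp [par, armv, fst]
  -- the assignment
  have hex : ∀ i : Fin (3 * m), ∃ j : Fin m, ∀ t < n,
      (∃ p, q t = armv i p) ∨ (∃ p, q (t + 1) = armv i p) →
      j.val * (2 * B + 2) ≤ t ∧ t < j.val * (2 * B + 2) + 2 * B := by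
    intro i
    obtain ⟨t1, ht1, -, h1⟩ := hdn (Sum.inl ⟨i, fst i⟩)
    obtain ⟨j, hj, t0, ha, hb, -, -, hq0, hq1⟩ := harm i t1 ht1 (Or.inr ⟨fst i, h1⟩)
    refine ⟨⟨j, hj⟩, ?_⟩
    intro t ht hta
    obtain ⟨j', hj', t0', ha', hb', hc', hd', hq0', hq1'⟩ := harm i t ht hta
    have hbj := hblk j hj
    have hbj' := hblk j' hj'
    have : t0 = t0' := hinj t0 (by omega) t0' (by omega) (by rw [hq0, hq0']) (by rw [hq1, hq1'])
    subst this
    have : j = j' := by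
      rcases lt_trichotomy j j' with h | h | h
      · have := Nat.mul_le_mul_right (2 * B + 2) (Nat.succ_le_of_lt h)
        rw [Nat.succ_mul] at this
        omega
      · exact h
      · have := Nat.mul_le_mul_right (2 * B + 2) (Nat.succ_le_of_lt h)
        rw [Nat.succ_mul] at this
        omega
    subst this
    exact ⟨hc', hd'⟩
  choose f hf using hex
  refine ⟨f, ?_⟩
  have hle : ∀ j : Fin m, ∑ i ∈ Finset.univ.filter (fun i => f i = j), s i ≤ B := by
    intro j
    choose td htd1 htd2 htd3 using hdn
    choose tu htu1 htu2 htu3 using hup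
    let A := Finset.univ.filter (fun i => f i = j)
    let X : Finset (Σ i : Fin (3 * m), Fin (s i)) := A.sigma (fun i => Finset.univ)
    have hX : X.card = ∑ i ∈ A, s i := by
      simp [X, Finset.card_sigma]
    let F : (Σ i : Fin (3 * m), Fin (s i)) ⊕ (Σ i : Fin (3 * m), Fin (s i)) → ℕ :=
      Sum.elim (fun x => td (Sum.inl x)) (fun x => tu (Sum.inl x))
    have hFinj : Function.Injective F := by
      have e1 : ∀ x, q (td (Sum.inl x)) = (gE (m := m) (k := k) (s := s) (Sum.inl (Sum.inl x))).1 :=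
        fun x => htd2 _
      have e2 : ∀ x, q (td (Sum.inl x) + 1) =
        (gE (m := m) (k := k) (s := s) (Sum.inl (Sum.inl x))).2 := fun x => htd3 _
      have e3 : ∀ x, q (tu (Sum.inl x)) = (gE (m := m) (k := k) (s := s) (Sum.inr (Sum.inl x))).1 :=
        fun x => htu2 _
      have e4 : ∀ x, q (tu (Sum.inl x) + 1) =
        (gE (m := m) (k := k) (s := s) (Sum.inr (Sum.inl x))).2 := fun x => htu3 _
      rintro (x | x) (y | y) hxy
      · have hxy : td (Sum.inl x) = td (Sum.inl y) := hxy
        have := gE_inj (Prod.ext (by rw [← e1, hxy, e1]) (by rw [← e2, hxy, e2]) :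
          gE (m := m) (k := k) (s := s) (Sum.inl (Sum.inl x)) = gE (Sum.inl (Sum.inl y)))
        simpa using this
      · have hxy : td (Sum.inl x) = tu (Sum.inl y) := hxy
        have := gE_inj (Prod.ext (by rw [← e1, hxy, e3]) (by rw [← e2, hxy, e4]) :
          gE (m := m) (k := k) (s := s) (Sum.inl (Sum.inl x)) = gE (Sum.inr (Sum.inl y)))
        simp at this
      · have hxy : tu (Sum.inl x) = td (Sum.inl y) := hxy
        have := gE_inj (Prod.ext (by rw [← e3, hxy, e1]) (by rw [← e4, hxy, e2]) :
          gE (m := m) (k := k) (s := s) (Sum.inr (Sum.inl x)) = gE (Sum.inl (Sum.inl y)))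
        simp at this
      · have hxy : tu (Sum.inl x) = tu (Sum.inl y) := hxy
        have := gE_inj (Prod.ext (by rw [← e3, hxy, e3]) (by rw [← e4, hxy, e4]) :
          gE (m := m) (k := k) (s := s) (Sum.inr (Sum.inl x)) = gE (Sum.inr (Sum.inl y)))
        simpa using this
    have hsub : (X.disjSum X).image F ⊆
        Finset.Ico (j.val * (2 * B + 2)) (j.val * (2 * B + 2) + 2 * B) := by
      intro t ht
      obtain ⟨x, hx, rfl⟩ := Finset.mem_image.1 ht
      rw [Finset.mem_Ico]
      rcases x with x | x
      · have hx : x ∈ X := by simpa using hx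
        have hxj : f x.1 = j := by simpa [X, A] using hx
        rw [← hxj]
        exact hf x.1 _ (htd1 _) (Or.inr ⟨x.2, htd3 (Sum.inl x)⟩)
      · have hx : x ∈ X := by simpa using hx
        have hxj : f x.1 = j := by simpa [X, A] using hx
        rw [← hxj]
        exact hf x.1 _ (htu1 _) (Or.inl ⟨x.2, htu2 (Sum.inl x)⟩)
    have hc := Finset.card_le_card hsub
    rw [Finset.card_image_of_injective _ hFinj, Finset.card_disjSum, hX, Nat.card_Ico] at hc
    change ∑ i ∈ A, s i ≤ B
    omega
  have htot : ∑ j : Fin m, ∑ i ∈ Finset.univ.filter (fun i => f i = j), s i = ∑ j : Fin m, B := by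
    rw [Finset.sum_fiberwise]
    simp [hM]
  intro j
  exact (Finset.sum_eq_sum_iff_of_le (fun j _ => hle j)).1 htot j (Finset.mem_univ j)

end backward
end Stmt5

namespace Stmt5
section forward
variable {m k : ℕ} {s : Fin (3 * m) → ℕ}

/-- A walk from `u` at time `T` to `v` at time `T'` without waiting, visiting `S`. -/
def Seg {V : Type} (P : V → V → ℕ → Prop) (u v : V) (T T' : ℕ) (S : V → Prop) : Prop :=
  ∃ a : ℕ → V, a T = u ∧ a T' = v ∧ (∀ t, T ≤ t → t < T' → P (a t) (a (t + 1)) t) ∧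
    ∀ w, S w → ∃ t, T ≤ t ∧ t ≤ T' ∧ a t = w

theorem Seg.trans {V : Type} {P : V → V → ℕ → Prop} {u v w : V} {T T' T'' : ℕ}
    {S S' : V → Prop} (h1 : Seg P u v T T' S) (h2 : Seg P v w T' T'' S') (hT : T ≤ T')
    (hT' : T' ≤ T'') : Seg P u w T T'' (fun x => S x ∨ S' x) := by
  obtain ⟨a, a1, a2, a3, a4⟩ := h1
  obtain ⟨b, b1, b2, b3, b4⟩ := h2
  have hb : ∀ t, T' ≤ t → (if t ≤ T' then a t else b t) = b t := by
    intro t ht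
    split_ifs with h
    · rw [show t = T' by omega, a2, b1]
    · rfl
  have ha : ∀ t, t ≤ T' → (if t ≤ T' then a t else b t) = a t := fun t ht => if_pos ht
  refine ⟨fun t => if t ≤ T' then a t else b t, ?_, ?_, ?_, ?_⟩
  · exact (ha T hT).trans a1
  · exact (hb _ hT').trans b2
  · intro t ht ht'
    by_cases h : t < T'
    · simp only [ha t h.le, ha (t + 1) h]
      exact a3 t ht h
    · simp only [hb t (by omega), hb (t + 1) (by omega)]
      exact b3 t (by omega) ht'
  · rintro x (hx | hx)
    · obtain ⟨t, h1, h2, h3⟩ := a4 x hx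
      exact ⟨t, h1, by omega, (ha t h2).trans h3⟩
    · obtain ⟨t, h1, h2, h3⟩ := b4 x hx
      exact ⟨t, by omega, h2, (hb t h1).trans h3⟩

theorem Seg.mono {V : Type} {P : V → V → ℕ → Prop} {u v : V} {T T' : ℕ}
    {S S' : V → Prop} (h1 : Seg P u v T T' S) (h : ∀ x, S' x → S x) : Seg P u v T T' S' := by
  obtain ⟨a, a1, a2, a3, a4⟩ := h1
  exact ⟨a, a1, a2, a3, fun w hw => a4 w (h w hw)⟩

theorem Seg.refl {V : Type} {P : V → V → ℕ → Prop} {u : V} {T : ℕ} :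
    Seg P u u T T (fun _ => False) :=
  ⟨fun _ => u, rfl, rfl, fun t h1 h2 => by omega, fun _ h => h.elim⟩

/-- the vertex at depth `d` of arm `i` -/
def nodeA (i : Fin (3 * m)) (d : ℕ) : SpV m k s :=
  if h : 0 < d ∧ d ≤ s i then armv i ⟨d - 1, by omega⟩ else ctr

theorem nodeA_edge (i : Fin (3 * m)) (d : ℕ) (hd : d < s i) :
    sArmE (nodeA i d : SpV m k s) (nodeA i (d + 1)) := by
  have h1 : (nodeA i (d + 1) : SpV m k s) = armv i ⟨d, hd⟩ := by
    rw [nodeA, dif_pos ⟨by omega, by omega⟩]; rfl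
  rw [h1]
  cases d with
  | zero =>
    left
    exact ⟨i, _, rfl, by simp [nodeA], rfl⟩
  | succ d =>
    right
    refine ⟨i, ⟨d, by omega⟩, _, rfl, ?_, rfl⟩
    rw [nodeA, dif_pos ⟨by omega, by omega⟩]; rfl

theorem seg_arm (P : SpV m k s → SpV m k s → ℕ → Prop) (i : Fin (3 * m)) (T : ℕ)
    (hP : ∀ t, T ≤ t → t < T + 2 * s i → ∀ u v, symP sArmE u v → P u v t) :
    Seg P ctr ctr T (T + 2 * s i) (fun w => ∃ p, w = armv i p) := by
  refine ⟨fun t => nodeA i (if t - T ≤ s i then t - T else 2 * s i - (t - T)), ?_, ?_, ?_, ?_⟩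
  · simp [nodeA]
  · simp only [Nat.add_sub_cancel_left]
    split_ifs with h
    · have : s i = 0 := by omega
      simp [nodeA, this]
    · simp [nodeA]
  · intro t h1 h2
    apply hP t h1 h2
    by_cases h : t - T < s i
    · left
      simp only
      rw [if_pos (by omega), if_pos (by omega), show t + 1 - T = t - T + 1 by omega]
      exact nodeA_edge i _ h
    · right
      simp only
      have e1 : (if t - T ≤ s i then t - T else 2 * s i - (t - T)) = 2 * s i - (t + 1 - T) + 1 := by
        split_ifs <;> omega
      rw [e1, if_neg (by omega)]
      exact nodeA_edge i _ (by omega)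
  · rintro w ⟨p, rfl⟩
    refine ⟨T + (p.val + 1), by omega, by omega, ?_⟩
    simp only [Nat.add_sub_cancel_left]
    rw [if_pos (by omega), nodeA, dif_pos ⟨by omega, by omega⟩]
    rfl

theorem seg_arms (P : SpV m k s → SpV m k s → ℕ → Prop) (A : Finset (Fin (3 * m))) :
    ∀ T, (∀ t, T ≤ t → t < T + 2 * ∑ i ∈ A, s i → ∀ u v, symP sArmE u v → P u v t) →
    Seg P ctr ctr T (T + 2 * ∑ i ∈ A, s i) (fun w => ∃ i ∈ A, ∃ p, w = armv i p) := by
  classical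
  induction A using Finset.induction_on with
  | empty =>
    intro T _
    simpa using Seg.refl.mono (by simp)
  | insert i A hi ih =>
    intro T hP
    rw [Finset.sum_insert hi] at hP ⊢
    have h1 := seg_arm P i T (fun t h1 h2 => hP t h1 (by omega))
    have h2 := ih (T + 2 * s i) (fun t h1 h2 => hP t (by omega) (by omega))
    have h3 := h1.trans h2 (by omega) (by omega)
    rw [show T + 2 * (s i + ∑ i ∈ A, s i) = T + 2 * s i + 2 * ∑ i ∈ A, s i by ring]
    refine h3.mono ?_
    rintro w ⟨i', hi', hw⟩
    rcases Finset.mem_insert.1 hi' with rfl | hi'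
    · exact Or.inl hw
    · exact Or.inr ⟨i', hi', hw⟩

theorem seg_chk (P : SpV m k s → SpV m k s → ℕ → Prop) (j : Fin m) (T : ℕ)
    (hP : ∀ t, T ≤ t → t < T + 2 → ∀ u v, symP chkE u v → P u v t) :
    Seg P ctr ctr T (T + 2) (fun w => w = chk j) := by
  refine ⟨fun t => if t = T + 1 then chk j else ctr, by simp, by simp, ?_, ?_⟩
  · intro t h1 h2
    apply hP t h1 h2
    rcases (by omega : t = T ∨ t = T + 1) with rfl | rfl
    · left; exact ⟨j, by simp, by simp⟩
    · right; exact ⟨j, by simp, by simp⟩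
  · rintro w rfl
    exact ⟨T + 1, by omega, by omega, by simp⟩

def nodeL (d : ℕ) : SpV m k s :=
  if h : 0 < d ∧ d ≤ k then lng ⟨d - 1, by omega⟩ else ctr

theorem nodeL_edge (d : ℕ) (hd : d < k) :
    lngE d (nodeL d : SpV m k s) (nodeL (d + 1)) := by
  have h1 : (nodeL (d + 1) : SpV m k s) = lng ⟨d, hd⟩ := by
    rw [nodeL, dif_pos ⟨by omega, by omega⟩]; rfl
  rw [h1]
  cases d with
  | zero =>
    left
    exact ⟨_, rfl, rfl, by simp [nodeL], rfl⟩
  | succ d =>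
    right
    refine ⟨⟨d, by omega⟩, _, rfl, rfl, ?_, rfl⟩
    rw [nodeL, dif_pos ⟨by omega, by omega⟩]; rfl

theorem seg_long (P : SpV m k s → SpV m k s → ℕ → Prop) (T : ℕ)
    (hP : ∀ d < k, ∀ u v, lngE d u v → P u v (T + d)) :
    Seg P ctr (nodeL k) T (T + k) (fun w => ∃ p, w = lng p) := by
  refine ⟨fun t => nodeL (t - T), by simp [nodeL], by simp, ?_, ?_⟩
  · intro t h1 h2
    have := hP (t - T) (by omega) _ _ (nodeL_edge (t - T) (by omega))
    simp only
    rw [show t + 1 - T = t - T + 1 by omega]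
    rwa [show T + (t - T) = t by omega] at this
  · rintro w ⟨p, rfl⟩
    refine ⟨T + (p.val + 1), by omega, by omega, ?_⟩
    simp only [Nat.add_sub_cancel_left]
    rw [nodeL, dif_pos ⟨by omega, by omega⟩]
    rfl

theorem sym_adj {u v : SpV m k s} (h : Down u v ∨ Down v u) : (spiderG m k s).Adj u v :=
  adj_iff.2 h

theorem forward (m B Δ k : ℕ)
    (s : Fin (3 * m) → ℕ) (hM : ∑ i, s i = m * B)
    (h : ∃ f : Fin (3 * m) → Fin m, ∀ j : Fin m,
        ∑ i ∈ Finset.univ.filter (fun i => f i = j), s i = B) :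
    ∃ J, (𝒢 m k s Δ B).IsCoveringFrom J ctr ∧
        arrival J 0 ≤ 2 * (∑ i, s i) + 2 * m + k := by
  obtain ⟨f, hf⟩ := h
  let P : SpV m k s → SpV m k s → ℕ → Prop := fun u v t =>
    (𝒢 m k s Δ B).G.Adj u v ∧ (𝒢 m k s Δ B).avail u v t
  have hblock : ∀ j : Fin m, Seg P ctr ctr (j.val * (2 * B + 2)) (j.val * (2 * B + 2) + 2 * B + 2)
      (fun w => (∃ i, f i = j ∧ ∃ p, w = armv i p) ∨ w = chk j) := by
    intro j
    have h1 := seg_arms P (Finset.univ.filter (fun i => f i = j)) (j.val * (2 * B + 2)) (by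
      intro t h1 h2 u v huv
      rw [hf j] at h2
      refine ⟨sym_adj (huv.imp Or.inl Or.inl), ?_⟩
      rw [show t = j.val * (2 * B + 2) + (t - j.val * (2 * B + 2)) by omega]
      exact (avail_take Δ B u v j _ j.2 (by omega)).2 (Or.inl huv))
    rw [hf j] at h1
    have h2 := seg_chk P j (j.val * (2 * B + 2) + 2 * B) (by
      intro t h1 h2 u v huv
      refine ⟨sym_adj (huv.imp (fun h => Or.inr (Or.inl h)) (fun h => Or.inr (Or.inl h))), ?_⟩
      rw [show t = j.val * (2 * B + 2) + 2 * B + (t - (j.val * (2 * B + 2) + 2 * B)) by omega]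
      exact (avail_check Δ B u v j _ j.2 (by omega)).2 (Or.inl huv))
    refine (h1.trans h2 (by omega) (by omega)).mono ?_
    rintro w (⟨i, hi, hw⟩ | hw)
    · exact Or.inl ⟨i, by simpa using hi, hw⟩
    · exact Or.inr hw
  have hall : ∀ n ≤ m, Seg P ctr ctr 0 (n * (2 * B + 2))
      (fun w => ∃ j : Fin m, j.val < n ∧ ((∃ i, f i = j ∧ ∃ p, w = armv i p) ∨ w = chk j)) := by
    intro n
    induction n with
    | zero =>
      intro _
      simpa using Seg.refl.mono (by simp)
    | succ n ih =>
      intro hn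
      have h1 := (ih (by omega)).trans (hblock ⟨n, by omega⟩) (by omega) (by simp only; omega)
      rw [show (n + 1) * (2 * B + 2) = n * (2 * B + 2) + 2 * B + 2 by ring]
      refine h1.mono ?_
      rintro w ⟨j, hj, hw⟩
      by_cases hjn : j.val = n
      · right
        have : j = ⟨n, by omega⟩ := Fin.ext hjn
        rw [← this]
        exact hw
      · left
        exact ⟨j, by omega, hw⟩
  have hlong := seg_long P (m * (2 * B + 2)) (by
    intro d hd u v huv
    refine ⟨sym_adj (Or.inl (Or.inr (Or.inr ⟨d, huv⟩))), ?_⟩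
    exact (avail_finish Δ B u v d hd).2 (Or.inr ⟨d, Or.inl huv, Or.inr rfl⟩))
  obtain ⟨a, a1, a2, a3, a4⟩ := (hall m le_rfl).trans hlong (by omega) (by omega)
  have hD : m * (2 * B + 2) = 2 * (∑ i, s i) + 2 * m := by rw [hM]; ring
  rw [hD] at a2 a3 a4
  set D := 2 * (∑ i, s i) + 2 * m + k with hDD
  have hvis : ∀ w : SpV m k s, ∃ t ≤ D, a t = w := by
    intro w
    rcases w with w | ⟨i, p⟩ | j | p
    · exact ⟨0, by omega, a1⟩
    · obtain ⟨t, -, h⟩ := a4 (armv i p) (Or.inl ⟨f i, (f i).2, Or.inl ⟨i, rfl, p, rfl⟩⟩)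
      exact ⟨t, h⟩
    · obtain ⟨t, -, h⟩ := a4 (chk j) (Or.inl ⟨j, j.2, Or.inr rfl⟩)
      exact ⟨t, h⟩
    · obtain ⟨t, -, h⟩ := a4 (lng p) (Or.inr ⟨p, rfl⟩)
      exact ⟨t, h⟩
  refine ⟨(List.range D).map (fun t => (a t, a (t + 1), t)), ⟨⟨?_, ?_⟩, ?_, ?_⟩, ?_⟩
  · intro x hx
    obtain ⟨t, ht, rfl⟩ := List.mem_map.1 hx
    exact a3 t (by omega) (List.mem_range.1 ht)
  · apply List.isChain_iff_getElem.2
    intro i hi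
    simp [Linked]
  · intro x hx
    cases hDc : D with
    | zero => simp [hDc] at hx
    | succ n =>
      rw [hDc, List.range_succ_eq_map] at hx
      simp at hx
      rw [← hx]
      exact a1
  · intro w
    obtain ⟨t, ht, rfl⟩ := hvis w
    cases t with
    | zero => left; exact a1
    | succ t =>
      right
      exact ⟨(a t, a (t + 1), t), List.mem_map.2 ⟨t, List.mem_range.2 ht, rfl⟩, rfl⟩
  · cases hDc : D with
    | zero => simp [arrival]
    | succ n => simp [arrival, List.range_succ]

end forward
end Stmt5

open Stmt5 in
/-- For positive integers `s_1,…,s_{3m}` of sum `M = mB`, `Δ ≥ 2` and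
`k > 2M + 2m`, the spider TVG admits a journey from the center at time `0` covering all
vertices by time `D = 2M + 2m + k` iff the integers can be partitioned into `m`
multisets each of sum `B`. -/
theorem spider_threePartition_reduction (m B Δ k : ℕ) (hΔ : 2 ≤ Δ)
    (s : Fin (3 * m) → ℕ) (hs : ∀ i, 0 < s i) (hM : ∑ i, s i = m * B)
    (hk : 2 * (∑ i, s i) + 2 * m < k) :
    (∃ J, (𝒢 m k s Δ B).IsCoveringFrom J ctr ∧
        arrival J 0 ≤ 2 * (∑ i, s i) + 2 * m + k) ↔
      ∃ f : Fin (3 * m) → Fin m, ∀ j : Fin m,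
        ∑ i ∈ Finset.univ.filter (fun i => f i = j), s i = B := by
  exact ⟨Stmt5.backward m B Δ k hΔ s hs hM hk, Stmt5.forward m B Δ k s hM⟩
end

section
/- Let 𝒢 be a TVG in class R whose underlying graph is a spider with center c and α ≥ 1 arms a_1,…,a_α each of length l, with an agent starting at c at time 0. Partition the timeline into blocks b_1,…,b_α, where b_j = [2l(j−1), 2lj) for 1 ≤ j < α and b_α = [2l(α−1), 2l(α−1)+l). Then there exists a covering journey from c at time 0 of temporal length exactly 2αl − l (equivalently, a covering journey that never waits) if and only if there is a perfect matching in the bipartite graph whose parts are the arms and the blocks, in which arm a_i is adjacent to block b_j if and only if a_i can be traversed without waiting during b_j (a round trip from c to the leaf of a_i and back for j < α, and a one-way trip from c to the leaf of a_i for j = α). -/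
open TVG

namespace Stmt18

/-- Vertices of the spider: the center and, for each of the `α` arms, `l` arm vertices
(position `p` is the `(p+1)`-st vertex of the arm; position `l - 1` is the leaf). -/
abbrev SpV (α l : ℕ) := Unit ⊕ Fin α × Fin l

variable {α l : ℕ}

def ctr : SpV α l := Sum.inl ()
def node (i : Fin α) (p : Fin l) : SpV α l := Sum.inr (i, p)

/-- The underlying spider with `α` arms of uniform length `l`. -/
def spiderG (α l : ℕ) : SimpleGraph (SpV α l) :=
  SimpleGraph.fromRel (fun u v =>
    (∃ (i : Fin α) (p : Fin l), p.val = 0 ∧ u = ctr ∧ v = node i p) ∨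
    (∃ (i : Fin α) (p q : Fin l), q.val = p.val + 1 ∧ u = node i p ∧ v = node i q))

/-- The vertices, in order, of a waiting-free round trip of arm `i`:
out to the leaf and back to the center. -/
def roundTargets (i : Fin α) [NeZero l] : List (SpV α l) :=
  (List.finRange l).map (node i) ++
    (((List.finRange l).reverse.drop 1).map (node i) ++ [ctr])

/-- The vertices, in order, of a waiting-free one-way trip of arm `i` to its leaf. -/
def oneWayTargets (i : Fin α) : List (SpV α l) := (List.finRange l).map (node i)

/-- Arm `i` can be traversed without waiting (round trip from the center to the leaf and
back) during the `(j+1)`-st block `[2lj, 2l(j+1))`. -/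
def canRound (𝒢 : TVG (SpV α l)) [NeZero l] (i : Fin α) (j : ℕ) : Prop :=
  ∃ J : List (TVG.Step (SpV α l)), 𝒢.IsJourney J ∧ startsAt J ctr ∧
    J.map (fun x => x.2.1) = roundTargets i ∧
    J.map (fun x => x.2.2) = List.range' (2 * l * j) (2 * l)

/-- Arm `i` can be traversed without waiting (one-way from the center to the leaf)
during the final block `[2l(α-1), 2l(α-1)+l)`. -/
def canOneWay (𝒢 : TVG (SpV α l)) (i : Fin α) : Prop :=
  ∃ J : List (TVG.Step (SpV α l)), 𝒢.IsJourney J ∧ startsAt J ctr ∧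
    J.map (fun x => x.2.1) = oneWayTargets i ∧
    J.map (fun x => x.2.2) = List.range' (2 * l * (α - 1)) l

end Stmt18

namespace Stmt18

/-- vertex at depth `d` of arm `i` -/
def vtx {α l : ℕ} (i : Fin α) (d : ℕ) : SpV α l :=
  if h : 0 < d ∧ d ≤ l then node i ⟨d - 1, by omega⟩ else ctr

/-- position after `s` steps of a round trip -/
def pos {α l : ℕ} (i : Fin α) (s : ℕ) : SpV α l := vtx i (if s ≤ l then s else 2 * l - s)

/-- signed coordinate along arm `i` -/
def crd {α l : ℕ} (i : Fin α) : SpV α l → ℤ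
  | Sum.inl _ => 0
  | Sum.inr (j, p) => if j = i then (p.val : ℤ) + 1 else -((p.val : ℤ) + 1)

lemma crd_lip {α l : ℕ} (i : Fin α) (u v : SpV α l) (h : (spiderG α l).Adj u v) :
    crd i u ≤ crd i v + 1 ∧ crd i v ≤ crd i u + 1 := by
  have key : ∀ u v : SpV α l, ((∃ (i : Fin α) (p : Fin l), p.val = 0 ∧ u = ctr ∧ v = node i p) ∨
    (∃ (i : Fin α) (p q : Fin l), q.val = p.val + 1 ∧ u = node i p ∧ v = node i q)) →
    crd i u ≤ crd i v + 1 ∧ crd i v ≤ crd i u + 1 := by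
    rintro u v (⟨j, p, hp, rfl, rfl⟩ | ⟨j, p, q, hp, rfl, rfl⟩)
    · simp only [crd, ctr, node]; split_ifs <;> omega
    · simp only [crd, node]; split_ifs <;> omega
  rw [spiderG, SimpleGraph.fromRel_adj] at h
  rcases h.2 with h | h
  · exact key _ _ h
  · exact (key _ _ h).symm

lemma crd_le {α l : ℕ} (i : Fin α) (v : SpV α l) : crd i v ≤ l := by
  rcases v with _ | ⟨j, p⟩
  · simp [crd]
  · have := p.2
    simp only [crd]; split_ifs <;> omega

lemma eq_vtx {α l : ℕ} (i : Fin α) (v : SpV α l) (d : ℕ) (h : crd i v = d) : v = vtx i d := by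
  rcases v with _ | ⟨j, p⟩
  · simp only [crd] at h
    have : d = 0 := by omega
    subst this
    simp [vtx, ctr]
  · have := p.2
    simp only [crd] at h
    split_ifs at h with hj
    · subst hj
      have hd : d = p.val + 1 := by omega
      subst hd
      have h2 : 0 < p.val + 1 ∧ p.val + 1 ≤ l := by omega
      simp [vtx, h2, node]
    · omega

lemma crd_leaf_ne {α l : ℕ} (i j : Fin α) (hij : i ≠ j) (v : SpV α l) (hl : 0 < l)
    (h : crd j v = l) : crd i v = -l := by
  rcases v with _ | ⟨k, p⟩
  · simp only [crd] at h; omega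
  · have := p.2
    simp only [crd] at h ⊢
    split_ifs at h with hj
    · subst hj
      rw [if_neg (Ne.symm hij)]; omega
    · omega

lemma vtx_adj {α l : ℕ} (i : Fin α) (d : ℕ) (h : d < l) :
    (spiderG α l).Adj (vtx i d) (vtx i (d + 1)) := by
  rw [spiderG, SimpleGraph.fromRel_adj]
  rcases Nat.eq_zero_or_pos d with rfl | hd
  · have h2 : 0 < 0 + 1 ∧ 0 + 1 ≤ l := by omega
    simp only [vtx, h2, and_self, dite_true]
    refine ⟨by simp [ctr, node], Or.inl (Or.inl ⟨i, ⟨0, by omega⟩, rfl, by simp, rfl⟩)⟩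
  · have h1 : 0 < d ∧ d ≤ l := by omega
    have h2 : 0 < d + 1 ∧ d + 1 ≤ l := by omega
    simp only [vtx, h1, h2, and_self, dite_true]
    refine ⟨?_, Or.inl (Or.inr ⟨i, _, _, ?_, rfl, rfl⟩)⟩
    · simp [node]; omega
    · simp; omega

lemma pos_adj {α l : ℕ} (i : Fin α) (s : ℕ) (h : s < 2 * l) :
    (spiderG α l).Adj (pos i s) (pos i (s + 1)) := by
  unfold pos
  by_cases h1 : s < l
  · rw [if_pos h1.le, if_pos (by omega)]; exact vtx_adj i s h1
  · have e1 : (if s ≤ l then s else 2 * l - s) = (2 * l - s - 1) + 1 := by split_ifs <;> omega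
    have e2 : (if s + 1 ≤ l then s + 1 else 2 * l - (s + 1)) = (2 * l - s - 1) := by
      split_ifs <;> omega
    rw [e1, e2]
    exact (vtx_adj i _ (by omega)).symm

lemma pos_zero {α l : ℕ} (i : Fin α) : (pos i 0 : SpV α l) = ctr := by simp [pos, vtx]

lemma pos_two {α l : ℕ} (i : Fin α) : (pos i (2 * l) : SpV α l) = ctr := by
  unfold pos vtx
  split_ifs <;> first | rfl | omega

/-- waiting-free walk as a list of steps -/
def mkJ {V : Type} (W : ℕ → V) (a n : ℕ) : List (TVG.Step V) :=
  (List.range n).map (fun s => (W s, W (s + 1), a + s))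

lemma mkJ_journey {V : Type} (𝒢 : TVG V) (W : ℕ → V) (a n : ℕ)
    (h : ∀ s < n, 𝒢.G.Adj (W s) (W (s + 1)) ∧ 𝒢.avail (W s) (W (s + 1)) (a + s)) :
    𝒢.IsJourney (mkJ W a n) := by
  constructor
  · intro x hx
    simp only [mkJ, List.mem_map, List.mem_range] at hx
    obtain ⟨s, hs, rfl⟩ := hx
    exact h s hs
  · show List.IsChain _ _
    rw [List.isChain_iff_getElem]
    intro k hk
    simp [mkJ, Linked]

lemma mkJ_starts {V : Type} (W : ℕ → V) (a n : ℕ) : startsAt (mkJ W a n) (W 0) := by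
  intro x hx
  cases n with
  | zero => simp [mkJ] at hx
  | succ n =>
    simp [mkJ, List.head?_range] at hx
    rw [← hx]

lemma mkJ_times {V : Type} (W : ℕ → V) (a n : ℕ) :
    (mkJ W a n).map (fun x => x.2.2) = List.range' a n := by
  simp [mkJ, List.range'_eq_map_range, Function.comp_def]

lemma mkJ_targets {V : Type} (W : ℕ → V) (a n : ℕ) :
    (mkJ W a n).map (fun x => x.2.1) = (List.range n).map (fun s => W (s + 1)) := by
  simp [mkJ, Function.comp_def]

/-- the vertex after `k` steps -/
def trk {V : Type} (c : V) (J : List (TVG.Step V)) (k : ℕ) : V :=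
  (c :: J.map (fun x => x.2.1)).getD k c

lemma trk_zero {V : Type} (c : V) (J : List (TVG.Step V)) : trk c J 0 = c := by simp [trk]

lemma trk_succ {V : Type} (c : V) (J : List (TVG.Step V)) (k : ℕ) (h : k < J.length) :
    trk c J (k + 1) = J[k].2.1 := by simp [trk, h]

lemma trk_src {V : Type} (𝒢 : TVG V) (c : V) (J : List (TVG.Step V)) (hJ : 𝒢.IsJourney J)
    (hs : startsAt J c) (k : ℕ) (h : k < J.length) : J[k].1 = trk c J k := by
  cases k with
  | zero =>
    rw [trk_zero]; apply hs
    rw [List.head?_eq_getElem?, List.getElem?_eq_getElem h]; rfl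
  | succ k =>
    rw [trk_succ _ _ _ (by omega)]
    have := hJ.2
    change List.IsChain _ _ at this
    rw [List.isChain_iff_getElem] at this
    exact (this k h).1

lemma trk_step {V : Type} (𝒢 : TVG V) (c : V) (J : List (TVG.Step V)) (hJ : 𝒢.IsJourney J)
    (hs : startsAt J c) (k : ℕ) (h : k < J.length) :
    𝒢.G.Adj (trk c J k) (trk c J (k + 1)) ∧ 𝒢.avail (trk c J k) (trk c J (k + 1)) J[k].2.2 := by
  rw [trk_succ _ _ _ h, ← trk_src 𝒢 c J hJ hs k h]
  exact hJ.1 _ (List.getElem_mem h)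

lemma times_mono {V : Type} (𝒢 : TVG V) (J : List (TVG.Step V)) (hJ : 𝒢.IsJourney J)
    (k m : ℕ) (h : k + m < J.length) : J[k].2.2 + m ≤ J[k + m].2.2 := by
  induction m with
  | zero => simp
  | succ m ih =>
    have h1 := ih (by omega)
    have := hJ.2
    change List.IsChain _ _ at this
    rw [List.isChain_iff_getElem] at this
    have h2 := (this (k + m) (by omega)).2
    have e : J[k + m + 1].2.2 = J[k + (m + 1)].2.2 := rfl
    omega

lemma of_lists {V : Type} (𝒢 : TVG V) (W : ℕ → V) (a n : ℕ) (J : List (TVG.Step V))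
    (hJ : 𝒢.IsJourney J) (hs : startsAt J (W 0))
    (ht : J.map (fun x => x.2.1) = (List.range n).map (fun s => W (s + 1)))
    (hT : J.map (fun x => x.2.2) = List.range' a n) :
    ∀ s < n, 𝒢.avail (W s) (W (s + 1)) (a + s) := by
  have hlen : J.length = n := by simpa using congrArg List.length ht
  have htr : ∀ s ≤ n, trk (W 0) J s = W s := by
    intro s hsn
    cases s with
    | zero => exact trk_zero _ _
    | succ s =>
      simp only [trk, ht]
      have : s < n := hsn
      simp [this]
  intro s hsn
  have h1 := (trk_step 𝒢 (W 0) J hJ hs s (by omega)).2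
  rw [htr s hsn.le, htr (s + 1) hsn] at h1
  have h2 : J[s].2.2 = a + s := by
    have h3 := congrArg (fun L => L[s]?) hT
    simp [hsn, hlen] at h3
    simpa using h3
  rwa [h2] at h1

lemma oneWayTargets_eq {α l : ℕ} (i : Fin α) :
    (oneWayTargets i : List (SpV α l)) = (List.range l).map (fun s => pos i (s + 1)) := by
  apply List.ext_getElem
  · simp [oneWayTargets]
  · intro k h1 h2
    have hk : k < l := by simpa using h2
    simp only [oneWayTargets, List.getElem_map, List.getElem_finRange, List.getElem_range]
    have h3 : k + 1 ≤ l := hk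
    simp [pos, vtx, h3]

lemma roundTargets_eq {α l : ℕ} [NeZero l] (i : Fin α) :
    (roundTargets i : List (SpV α l)) = (List.range (2 * l)).map (fun s => pos i (s + 1)) := by
  have hl : 0 < l := NeZero.pos l
  apply List.ext_getElem
  · simp [roundTargets]; omega
  · intro k h1 h2
    have hk : k < 2 * l := by simpa using h2
    simp only [roundTargets, List.getElem_append, List.getElem_map, List.length_map,
      List.length_finRange, List.getElem_range, List.getElem_drop, List.getElem_reverse,
      List.getElem_finRange, List.length_drop, List.length_reverse]
    by_cases c1 : k < l
    · have h3 : k + 1 ≤ l := c1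
      simp [pos, vtx, h3, c1]
    · rw [dif_neg c1]
      have h3 : ¬ k + 1 ≤ l := by omega
      by_cases c2 : k - l < l - 1
      · rw [dif_pos c2]
        have h4 : 0 < 2 * l - (k + 1) ∧ 2 * l - (k + 1) ≤ l := by omega
        simp only [pos, vtx, h3, h4, if_false, and_self, dite_true]
        congr 1
        ext
        simp
        omega
      · rw [dif_neg c2]
        have : k + 1 = 2 * l := by omega
        rw [this, pos_two]
        simp

lemma canRound_iff {α l : ℕ} [NeZero l] (𝒢 : TVG (SpV α l)) (hG : 𝒢.G = spiderG α l)
    (i : Fin α) (j : ℕ) :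
    canRound 𝒢 i j ↔ ∀ s < 2 * l, 𝒢.avail (pos i s) (pos i (s + 1)) (2 * l * j + s) := by
  constructor
  · rintro ⟨J, h1, h2, h3, h4⟩
    rw [roundTargets_eq] at h3
    exact of_lists 𝒢 (pos i) _ _ J h1 (by rwa [pos_zero]) h3 h4
  · intro h
    refine ⟨mkJ (pos i) (2 * l * j) (2 * l), mkJ_journey _ _ _ _ ?_, ?_, ?_, mkJ_times _ _ _⟩
    · intro s hs
      exact ⟨hG ▸ pos_adj i s hs, h s hs⟩
    · rw [← pos_zero i]; exact mkJ_starts _ _ _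
    · rw [roundTargets_eq, mkJ_targets]

lemma canOneWay_iff {α l : ℕ} (𝒢 : TVG (SpV α l)) (hG : 𝒢.G = spiderG α l)
    (i : Fin α) :
    canOneWay 𝒢 i ↔ ∀ s < l, 𝒢.avail (pos i s) (pos i (s + 1)) (2 * l * (α - 1) + s) := by
  constructor
  · rintro ⟨J, h1, h2, h3, h4⟩
    rw [oneWayTargets_eq] at h3
    exact of_lists 𝒢 (pos i) _ _ J h1 (by rwa [pos_zero]) h3 h4
  · intro h
    refine ⟨mkJ (pos i) (2 * l * (α - 1)) l, mkJ_journey _ _ _ _ ?_, ?_, ?_, mkJ_times _ _ _⟩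
    · intro s hs
      exact ⟨hG ▸ pos_adj i s (by omega), h s hs⟩
    · rw [← pos_zero i]; exact mkJ_starts _ _ _
    · rw [oneWayTargets_eq, mkJ_targets]

lemma arith_N (α l : ℕ) (hα : 0 < α) : 2 * α * l - l = 2 * l * (α - 1) + l := by
  obtain ⟨a, rfl⟩ : ∃ a, α = a + 1 := ⟨α - 1, by omega⟩
  have : 2 * (a + 1) * l = 2 * l * a + l + l := by ring
  rw [this]; simp

lemma backward (α l : ℕ) (hα : 0 < α) [NeZero l]
    (𝒢 : TVG (SpV α l)) (hG : 𝒢.G = spiderG α l) (σ : Equiv.Perm (Fin α))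
    (hσ : ∀ i : Fin α,
      if (σ i).val = α - 1 then canOneWay 𝒢 i else canRound 𝒢 i (σ i).val) :
    ∃ J, 𝒢.IsCoveringFrom J ctr ∧ arrival J 0 = 2 * α * l - l := by
  have hl : 0 < l := NeZero.pos l
  let arm : ℕ → Fin α := fun k => if h : k < α then σ.symm ⟨k, h⟩ else ⟨0, hα⟩
  let W : ℕ → SpV α l := fun t => pos (arm (t / (2 * l))) (t % (2 * l))
  have hW : ∀ j s, s < 2 * l → W (2 * l * j + s) = pos (arm j) s := by
    intro j s hs
    simp only [W]
    rw [Nat.mul_add_div (by omega), Nat.mul_add_mod, Nat.div_eq_of_lt hs, Nat.mod_eq_of_lt hs]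
    rfl
  have hW1 : ∀ j s, s < 2 * l → W (2 * l * j + s + 1) = pos (arm j) (s + 1) := by
    intro j s hs
    by_cases h : s + 1 < 2 * l
    · exact hW j (s + 1) h
    · have e : s + 1 = 2 * l := by omega
      have e2 : 2 * l * j + s + 1 = 2 * l * (j + 1) + 0 := by rw [mul_add]; omega
      rw [e2, hW _ _ (by omega), e, pos_two, pos_zero]
  have hN := arith_N α l hα
  set N := 2 * α * l - l with hNdef
  have hdec : ∀ t < N, ∃ j s, j < α ∧ s < 2 * l ∧ t = 2 * l * j + s ∧ (j = α - 1 → s < l) := by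
    intro t ht
    refine ⟨t / (2 * l), t % (2 * l), ?_, Nat.mod_lt _ (by omega), (Nat.div_add_mod _ _).symm, ?_⟩
    · rw [Nat.div_lt_iff_lt_mul (by omega)]
      have : α * (2 * l) = 2 * l * (α - 1) + 2 * l := by
        obtain ⟨a, rfl⟩ : ∃ a, α = a + 1 := ⟨α - 1, by omega⟩
        simp; ring
      omega
    · intro h
      have := Nat.div_add_mod t (2 * l)
      rw [h] at this
      omega
  refine ⟨mkJ W 0 N, ⟨mkJ_journey _ _ _ _ ?_, ?_, ?_⟩, ?_⟩
  · intro t ht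
    obtain ⟨j, s, hj, hs, rfl, hlast⟩ := hdec t ht
    rw [hW _ _ hs, hW1 _ _ hs, zero_add]
    refine ⟨hG ▸ pos_adj _ _ hs, ?_⟩
    have h1 := hσ (arm j)
    have h2 : (σ (arm j)).val = j := by simp [arm, hj]
    rw [h2] at h1
    split_ifs at h1 with h3
    · rw [canOneWay_iff 𝒢 hG] at h1
      have := h1 s (hlast h3)
      rwa [← h3] at this
    · rw [canRound_iff 𝒢 hG] at h1
      exact h1 s hs
  · have : W 0 = ctr := by
      have := hW 0 0 (by omega)
      simpa [pos_zero] using this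
    rw [← this]; exact mkJ_starts _ _ _
  · rintro (_ | ⟨i, p⟩)
    · left; rfl
    · right
      have hp := p.2
      have hle : 2 * l * (σ i).val ≤ 2 * l * (α - 1) :=
        Nat.mul_le_mul_left _ (by have := (σ i).2; omega)
      refine ⟨_, List.mem_map.2 ⟨2 * l * (σ i).val + p.val, List.mem_range.2 (by omega), rfl⟩, ?_⟩
      show W (2 * l * (σ i).val + p.val + 1) = _
      rw [hW1 _ _ (by omega)]
      have : arm (σ i).val = i := by simp [arm]
      have h3 : p.val + 1 ≤ l := hp
      rw [this]
      simp [pos, vtx, h3, node]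
  · have : N = (N - 1) + 1 := by omega
    rw [this]
    simp [arrival, mkJ, List.range_succ]

lemma lip_le (g : ℕ → ℤ) (n : ℕ) (hg : ∀ k < n, g k ≤ g (k + 1) + 1 ∧ g (k + 1) ≤ g k + 1)
    (a m : ℕ) (h : a + m ≤ n) : g a ≤ g (a + m) + m ∧ g (a + m) ≤ g a + m := by
  induction m with
  | zero => simp
  | succ m ih =>
    have h1 := ih (by omega)
    have h2 := hg (a + m) (by omega)
    rw [show a + (m + 1) = a + m + 1 by rfl]
    push_cast
    omega

lemma forward (α l : ℕ) (hα : 0 < α) [NeZero l]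
    (𝒢 : TVG (SpV α l)) (hG : 𝒢.G = spiderG α l) (J : List (TVG.Step (SpV α l)))
    (hJ : 𝒢.IsCoveringFrom J ctr) (hA : arrival J 0 = 2 * α * l - l) :
    ∃ σ : Equiv.Perm (Fin α), ∀ i : Fin α,
      if (σ i).val = α - 1 then canOneWay 𝒢 i else canRound 𝒢 i (σ i).val := by
  have hl : 0 < l := NeZero.pos l
  obtain ⟨hj, hs, hc⟩ := hJ
  have hN := arith_N α l hα
  rw [hN] at hA
  set n := J.length with hn
  -- times
  have hnpos : 0 < n := by
    rcases Nat.eq_zero_or_pos n with h | h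
    · rw [hn, List.length_eq_zero_iff] at h
      subst h
      simp [arrival] at hA
      omega
    · exact h
  have hlast : J[n - 1].2.2 + 1 = 2 * l * (α - 1) + l := by
    rw [← hA, arrival, List.getLast?_eq_getElem?, List.getElem?_eq_getElem (by omega)]
    rfl
  have hlow : ∀ k (h : k < n), k ≤ J[k].2.2 := by
    intro k h
    have := times_mono 𝒢 J hj 0 k (by omega)
    simp only [zero_add] at this
    omega
  have hnN : n ≤ 2 * l * (α - 1) + l := by
    have := hlow (n - 1) (by omega)
    omega
  let w := trk ctr J
  have hstep := trk_step 𝒢 ctr J hj hs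
  have hlip : ∀ i : Fin α, ∀ a m, a + m ≤ n →
      crd i (w a) ≤ crd i (w (a + m)) + m ∧ crd i (w (a + m)) ≤ crd i (w a) + m := by
    intro i
    apply lip_le (fun k => crd i (w k)) n
    intro k hk
    apply crd_lip
    rw [← hG]; exact (hstep k hk).1
  have hw0 : ∀ i, crd i (w 0) = 0 := by
    intro i; simp [w, trk_zero, crd, ctr]
  have hvis : ∀ i : Fin α, ∃ T ≤ n, crd i (w T) = l := by
    intro i
    rcases hc (node i ⟨l - 1, by omega⟩) with h | ⟨x, hx, h⟩
    · simp [node, ctr] at h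
    · obtain ⟨k, hk, rfl⟩ := List.getElem_of_mem hx
      refine ⟨k + 1, hk, ?_⟩
      simp only [w]
      rw [trk_succ _ _ _ hk, h]
      simp [node, crd]; omega
  choose T hTn hT using hvis
  have hTl : ∀ i, l ≤ T i := by
    intro i
    have := (hlip i 0 (T i) (by simpa using hTn i)).2
    rw [zero_add, hw0, hT] at this
    omega
  have hgap : ∀ i j, i ≠ j → T i ≤ T j → T i + 2 * l ≤ T j := by
    intro i j hij hle
    have h1 := (hlip i (T i) (T j - T i) (by have := hTn j; omega)).1
    rw [Nat.add_sub_cancel' hle, hT, crd_leaf_ne i j hij _ hl (hT j)] at h1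
    omega
  have hq : ∀ i, 2 * l * ((T i - l) / (2 * l)) ≤ T i - l := fun i => Nat.mul_div_le _ _
  have hq2 : ∀ i, T i - l < 2 * l * ((T i - l) / (2 * l)) + 2 * l := fun i => by
    have := Nat.lt_mul_div_succ (T i - l) (show 0 < 2 * l by omega)
    rw [mul_add] at this; omega
  have hqα : ∀ i, (T i - l) / (2 * l) < α := by
    intro i
    have h1 := hTn i
    have : (T i - l) / (2 * l) ≤ (2 * l * (α - 1)) / (2 * l) :=
      Nat.div_le_div_right (by omega)
    rw [Nat.mul_div_cancel_left _ (by omega)] at this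
    omega
  let f : Fin α → Fin α := fun i => ⟨(T i - l) / (2 * l), hqα i⟩
  have hinj : Function.Injective f := by
    intro i j hij
    by_contra hne
    have e : (T i - l) / (2 * l) = (T j - l) / (2 * l) := congrArg Fin.val hij
    have a1 := hq i
    have a2 := hq2 i
    have b1 := hq j
    have b2 := hq2 j
    rw [← e] at b1 b2
    have := hTl i
    have := hTl j
    rcases le_total (T i) (T j) with h | h
    · have := hgap i j hne h; omega
    · have := hgap j i (Ne.symm hne) h; omega
  let σ : Equiv.Perm (Fin α) := Equiv.ofBijective f (Finite.injective_iff_bijective.1 hinj)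
  have hσ : ∀ i, (σ i).val = (T i - l) / (2 * l) := fun i => rfl
  -- exact times
  have hup : ∀ m, ∀ i, (σ i).val + m = α - 1 → T i ≤ l + 2 * l * (σ i).val := by
    intro m
    induction m with
    | zero =>
      intro i hi
      have := hTn i
      rw [add_zero] at hi
      rw [hi]; omega
    | succ m ih =>
      intro i hi
      obtain ⟨j, hj⟩ := σ.surjective ⟨(σ i).val + 1, by omega⟩
      have hj' : (σ j).val = (σ i).val + 1 := by rw [hj]
      have h1 := ih j (by omega)
      have hne : i ≠ j := by rintro rfl; omega
      have hle : T i ≤ T j := by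
        by_contra hcon
        have : (T j - l) / (2 * l) ≤ (T i - l) / (2 * l) := Nat.div_le_div_right (by omega)
        rw [← hσ, ← hσ] at this
        omega
      have h2 := hgap i j hne hle
      rw [hj', mul_add] at h1
      omega
  have hTe : ∀ i, T i = 2 * l * (σ i).val + l := by
    intro i
    have h1 := hup (α - 1 - (σ i).val) i (by have := (σ i).2; omega)
    have h2 := hq i
    rw [← hσ] at h2
    have := hTl i
    omega
  have hnE : n = 2 * l * (α - 1) + l := by
    obtain ⟨j, hj⟩ := σ.surjective ⟨α - 1, by omega⟩
    have h1 := hTe j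
    rw [hj] at h1
    have := hTn j
    simp only at h1
    omega
  have htime : ∀ k (h : k < n), J[k].2.2 = k := by
    intro k h
    have h1 := hlow k h
    have h2 := times_mono 𝒢 J hj k (n - 1 - k) (by omega)
    have e : J[k + (n - 1 - k)].2.2 = J[n - 1].2.2 := by
      congr 3; omega
    omega
  -- positions
  have hA1 : ∀ i s, s ≤ l → w (2 * l * (σ i).val + s) = pos i s := by
    intro i s hsl
    rw [pos, if_pos hsl]
    apply eq_vtx
    have hTi := hTe i
    have hTi2 := hTn i
    have h1 := (hlip i (2 * l * (σ i).val + s) (l - s) (by omega)).2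
    rw [show 2 * l * (σ i).val + s + (l - s) = T i by omega, hT] at h1
    rcases Nat.eq_zero_or_pos (σ i).val with h0 | h0
    · have h2 := (hlip i 0 s (by omega)).2
      rw [hw0] at h2
      rw [h0] at h1 ⊢
      simp only [zero_add, mul_zero] at h1 h2 ⊢
      omega
    · obtain ⟨j, hj⟩ := σ.surjective ⟨(σ i).val - 1, by omega⟩
      have hj' : (σ i).val = (σ j).val + 1 := by rw [hj]; simp; omega
      have hne : i ≠ j := by rintro rfl; omega
      have hTj := hTe j
      have h2 := (hlip i (T j) (l + s) (by rw [hj', mul_add] at hTi; omega)).2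
      rw [crd_leaf_ne i j hne _ hl (hT j),
        show T j + (l + s) = 2 * l * (σ i).val + s by rw [hj', mul_add]; omega] at h2
      omega
  have hA2 : ∀ i s, (σ i).val ≠ α - 1 → s ≤ 2 * l → w (2 * l * (σ i).val + s) = pos i s := by
    intro i s hne hsl
    by_cases hs1 : s ≤ l
    · exact hA1 i s hs1
    rw [pos, if_neg hs1]
    apply eq_vtx
    have hσi := (σ i).2
    obtain ⟨j, hj⟩ := σ.surjective ⟨(σ i).val + 1, by omega⟩
    have hj' : (σ j).val = (σ i).val + 1 := by rw [hj]
    have hij : i ≠ j := by rintro rfl; omega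
    have hTi := hTe i
    have hTj := hTe j
    have hTjn := hTn j
    rw [hj', mul_add] at hTj
    have h1 := (hlip i (T i) (s - l) (by omega)).1
    rw [show T i + (s - l) = 2 * l * (σ i).val + s by omega, hT] at h1
    have h2 := (hlip i (2 * l * (σ i).val + s) (3 * l - s) (by omega)).1
    rw [show 2 * l * (σ i).val + s + (3 * l - s) = T j by omega,
      crd_leaf_ne i j hij _ hl (hT j)] at h2
    omega
  refine ⟨σ, fun i => ?_⟩
  have hTi := hTe i
  have hTin := hTn i
  split_ifs with h
  · rw [canOneWay_iff 𝒢 hG]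
    intro s hs'
    rw [← h, ← hA1 i s hs'.le, ← hA1 i (s + 1) hs']
    have hk : 2 * l * (σ i).val + s < n := by omega
    have := (hstep _ hk).2
    rwa [htime _ hk] at this
  · rw [canRound_iff 𝒢 hG]
    intro s hs'
    rw [← hA2 i s h hs'.le, ← hA2 i (s + 1) h hs']
    have hle : 2 * l * ((σ i).val + 1) ≤ 2 * l * (α - 1) :=
      Nat.mul_le_mul_left _ (by have := (σ i).2; omega)
    rw [mul_add] at hle
    have hk : 2 * l * (σ i).val + s < n := by omega
    have := (hstep _ hk).2
    rwa [htime _ hk] at this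

end Stmt18

open Stmt18 in
/-- For a TVG of class `R` over a spider with `α` arms of uniform
length `l`, with the agent starting at the center at time `0`: there is a covering
journey of temporal length exactly `2αl - l` (a waiting-free covering journey) iff there
is a perfect matching between arms and time blocks, arm `i` being matchable to block
`b_j` iff it can be traversed without waiting during `b_j` (a round trip for `j < α`,
a one-way trip to the leaf for `j = α`). -/
theorem spider_uniform_no_waiting_iff_matching (α l : ℕ) (hα : 0 < α) [NeZero l]
    (𝒢 : TVG (SpV α l)) (hG : 𝒢.G = spiderG α l) (hR : 𝒢.ClassR) :
    (∃ J, 𝒢.IsCoveringFrom J ctr ∧ arrival J 0 = 2 * α * l - l) ↔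
    (∃ σ : Equiv.Perm (Fin α), ∀ i : Fin α,
      if (σ i).val = α - 1 then canOneWay 𝒢 i else canRound 𝒢 i (σ i).val) := by
  exact ⟨fun ⟨J, h1, h2⟩ => forward α l hα 𝒢 hG J h1 h2,
    fun ⟨σ, h⟩ => backward α l hα 𝒢 hG σ h⟩
end
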